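/- arXiv:math/0507467 — 4 statements merged into one kernel-verified Lean document; each statement's English description precedes it below -/
import Mathlib

section
/- Let D ⊂ ℂ be a domain such that ℂ \ D is polar, and let ρ : D → [-∞,∞) be a constant function ρ ≡ c ∈ ℝ. Then L²_h(G_{D,ρ}) = {0}; in particular, the L²_h-holomorphic hull of G_{D,ρ} equals ℂ². -/
open MeasureTheory Filter Metric Set

/-- `elog x` is `log x` with value `-∞` for `x ≤ 0`, as an extended real. -/
noncomputable def elog (x : ℝ) : EReal := if x ≤ 0 then ⊥ else ((Real.log x : ℝ) : EReal)

/-- The sub-mean value inequality over circles of closed discs contained in `Ω`, phrased via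
continuous real-valued majorants of the (extended-real-valued) function on the circle. -/
def SubmeanOn (u : ℂ → EReal) (Ω : Set ℂ) : Prop :=
  ∀ c : ℂ, ∀ r : ℝ, 0 < r → Metric.closedBall c r ⊆ Ω →
    ∀ φ : ℝ → ℝ, Continuous φ →
      (∀ θ : ℝ, u (c + r * Complex.exp (θ * Complex.I)) ≤ ((φ θ : ℝ) : EReal)) →
      u c ≤ (((2 * Real.pi)⁻¹ * ∫ θ in (0:ℝ)..(2 * Real.pi), φ θ : ℝ) : EReal)

/-- `u : Ω → [-∞, ∞)` is subharmonic on the open set `Ω ⊆ ℂ`: upper semicontinuous,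
nowhere `+∞`, not identically `-∞` on any connected component, sub-mean value inequality. -/
def SubharmonicOn (u : ℂ → EReal) (Ω : Set ℂ) : Prop :=
  IsOpen Ω ∧ UpperSemicontinuousOn u Ω ∧
  (∀ z ∈ Ω, u z ≠ ⊤) ∧
  (∀ z ∈ Ω, ∃ w ∈ connectedComponentIn Ω z, u w ≠ ⊥) ∧
  SubmeanOn u Ω

/-- A set `E ⊆ ℂ` is polar if some subharmonic function on an open set containing `E`
equals `-∞` on `E`. -/
def PolarSet (E : Set ℂ) : Prop :=
  ∃ Ω : Set ℂ, E ⊆ Ω ∧ ∃ u : ℂ → EReal, SubharmonicOn u Ω ∧ ∀ z ∈ E, u z = ⊥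

/-- The space of square-integrable holomorphic functions on `D`. -/
def L2h {E : Type*} [NormedAddCommGroup E] [NormedSpace ℂ E] [MeasureSpace E]
    (D : Set E) : Set (E → ℂ) :=
  {f | DifferentiableOn ℂ f D ∧ IntegrableOn (fun z => ‖f z‖ ^ 2) D volume}

/-- `D` is an `L²ₕ`-domain of holomorphy. -/
def IsL2hDomainOfHolomorphy {E : Type*} [NormedAddCommGroup E] [NormedSpace ℂ E]
    [MeasureSpace E] (D : Set E) : Prop :=
  ¬ ∃ D₀ D₁ : Set E, IsOpen D₀ ∧ IsConnected D₀ ∧ IsOpen D₁ ∧ IsConnected D₁ ∧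
      D₀ ⊆ D₁ ∩ D ∧ ¬ (D₁ ⊆ D) ∧
      ∀ f ∈ L2h D, ∃ g : E → ℂ, DifferentiableOn ℂ g D₁ ∧ Set.EqOn g f D₀

/-- The Hartogs domain `G_{D,ρ} = {(z₁,z₂) : z₁ ∈ D, |z₂| < e^{-ρ(z₁)}}`. -/
def hartogs (D : Set ℂ) (ρ : ℂ → EReal) : Set (ℂ × ℂ) :=
  {p | p.1 ∈ D ∧ elog ‖p.2‖ < - ρ p.1}

/-- `S(D)`: boundary points near which the complement of `D` is polar. -/
def polarS (D : Set ℂ) : Set ℂ :=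
  {z ∈ frontier D | ∃ U : Set ℂ, IsOpen U ∧ z ∈ U ∧ PolarSet (U \ D)}

/-- `fj` is the family of coefficients of a Hartogs expansion of `f` on `G_{D,ρ}`. -/
def HartogsExpansion (D : Set ℂ) (ρ : ℂ → EReal) (f : ℂ × ℂ → ℂ) (fj : ℕ → ℂ → ℂ) : Prop :=
  (∀ j, DifferentiableOn ℂ (fj j) D) ∧
  ∀ p ∈ hartogs D ρ, HasSum (fun j => fj j p.1 * p.2 ^ j) (f p)

/-- `ρ_f(z) = limsup_j (1/j) log |f_j(z)|` for coefficients `fj`. -/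
noncomputable def coeffGrowth (fj : ℕ → ℂ → ℂ) (z : ℂ) : EReal :=
  Filter.limsup (fun (j : ℕ) => ((((j : ℝ)⁻¹ : ℝ)) : EReal) * elog ‖fj j z‖) Filter.atTop

/-- The upper semicontinuous regularization `g*`. -/
noncomputable def uscReg (g : ℂ → EReal) (z : ℂ) : EReal := Filter.limsup g (nhds z)

/-- `ρ̃ = sup_{f ∈ L²ₕ(G_{D,ρ})} (ρ_f)*`. -/
noncomputable def rhoTilde (D : Set ℂ) (ρ : ℂ → EReal) (z : ℂ) : EReal :=
  ⨆ fj ∈ {fj : ℕ → ℂ → ℂ | ∃ f ∈ L2h (hartogs D ρ), HartogsExpansion D ρ f fj},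
    uscReg (coeffGrowth fj) z

/-- `D̂ = D ∪ {z ∈ S(D) : limsup_{D ∋ w → z} ρ(w) < ∞}`. -/
def DHat (D : Set ℂ) (ρ : ℂ → EReal) : Set ℂ :=
  D ∪ {z ∈ polarS D | Filter.limsup ρ (nhdsWithin z D) < ⊤}

open Classical in
/-- `ρ̂`, extending `ρ` to `D̂` by boundary limsups. -/
noncomputable def rhoHat (D : Set ℂ) (ρ : ℂ → EReal) (z : ℂ) : EReal :=
  if z ∈ D then ρ z else Filter.limsup ρ (nhdsWithin z D)

/-- `u` is plurisubharmonic on an open `Ω ⊆ ℂⁿ`. -/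
def PlurisubharmonicOn {n : ℕ} (u : (Fin n → ℂ) → EReal) (Ω : Set (Fin n → ℂ)) : Prop :=
  IsOpen Ω ∧ UpperSemicontinuousOn u Ω ∧
  (∀ z ∈ Ω, u z ≠ ⊤) ∧
  (∀ z ∈ Ω, ∃ w ∈ connectedComponentIn Ω z, u w ≠ ⊥) ∧
  ∀ a b : Fin n → ℂ, SubmeanOn (fun lam => u (a + lam • b)) {lam : ℂ | a + lam • b ∈ Ω}

/-- A set `E ⊆ ℂⁿ` is pluripolar. -/
def PluripolarSet {n : ℕ} (E : Set (Fin n → ℂ)) : Prop :=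
  ∃ Ω : Set (Fin n → ℂ), E ⊆ Ω ∧
    ∃ u : (Fin n → ℂ) → EReal, PlurisubharmonicOn u Ω ∧ ∀ z ∈ E, u z = ⊥

/-- `D ⊆ ℂⁿ` is pseudoconvex: it admits a plurisubharmonic exhaustion function. -/
def IsPseudoconvex {n : ℕ} (D : Set (Fin n → ℂ)) : Prop :=
  ∃ u : (Fin n → ℂ) → EReal, PlurisubharmonicOn u D ∧
    ∀ c : ℝ, IsCompact {z | z ∈ D ∧ u z ≤ (c : EReal)}

/-- `L²ₕ(D)` is infinite dimensional: arbitrarily many elements that are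
linearly independent as functions on `D`. -/
def L2hInfiniteDim {E : Type*} [NormedAddCommGroup E] [NormedSpace ℂ E] [MeasureSpace E]
    (D : Set E) : Prop :=
  ∀ N : ℕ, ∃ fs : Fin N → E → ℂ, (∀ i, fs i ∈ L2h D) ∧
    ∀ c : Fin N → ℂ, (∀ z ∈ D, ∑ i, c i * fs i z = 0) → c = 0


/-- The supremal convolution of a bounded upper semicontinuous function with `-k|·|` yields
continuous majorants converging to it. -/
lemma UpperSemicontinuous.exists_continuous_majorants {h : ℝ → ℝ} (hh : UpperSemicontinuous h)
    {b : ℝ} (hb : ∀ x, h x ≤ b) :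
    ∃ φ : ℕ → ℝ → ℝ, (∀ k, Continuous (φ k)) ∧ (∀ k x, h x ≤ φ k x ∧ φ k x ≤ b) ∧
      ∀ x, Tendsto (fun k => φ k x) atTop (nhds (h x)) := by
  have hbdd : ∀ (k : ℕ) (x : ℝ), BddAbove (range fun s => h s - k * |x - s|) := fun k x =>
    ⟨b, by
      rintro _ ⟨s, rfl⟩
      have : (0 : ℝ) ≤ k * |x - s| := by positivity
      show h s - k * |x - s| ≤ b
      linarith [hb s]⟩
  have hle : ∀ (k : ℕ) (x : ℝ), h x ≤ ⨆ s, (h s - k * |x - s|) := fun k x => by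
    simpa using le_ciSup (hbdd k x) x
  have hub : ∀ (k : ℕ) (x : ℝ), (⨆ s, (h s - k * |x - s|)) ≤ b := fun k x =>
    ciSup_le fun s => by
      have : (0 : ℝ) ≤ k * |x - s| := by positivity
      linarith [hb s]
  refine ⟨fun k x => ⨆ s, (h s - k * |x - s|), fun k => ?_, fun k x => ⟨hle k x, hub k x⟩,
    fun x => ?_⟩
  · have : LipschitzWith (k : NNReal) fun x => ⨆ s, (h s - k * |x - s|) := by
      refine LipschitzWith.of_le_add_mul _ fun x y => ciSup_le fun s => ?_
      have h1 := le_ciSup (hbdd k y) s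
      have h2 : |y - s| ≤ |x - s| + dist x y := by
        rw [Real.dist_eq, abs_sub_comm x y]
        have := abs_add_le (y - x) (x - s)
        simp only [sub_add_sub_cancel] at this
        linarith
      have h3 : (k : ℝ) * |y - s| ≤ k * (|x - s| + dist x y) := by gcongr
      simp only [NNReal.coe_natCast] at *
      linarith
    exact this.continuous
  · rw [tendsto_order]
    refine ⟨fun y hy => Eventually.of_forall fun k => hy.trans_le (hle k x), fun y hy => ?_⟩
    obtain ⟨t, hxt, hty⟩ := exists_between hy
    obtain ⟨δ, hδ, hball⟩ := Metric.eventually_nhds_iff.1 (hh x t hxt)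
    obtain ⟨N, hN⟩ := exists_nat_gt ((b - t) / δ)
    filter_upwards [eventually_ge_atTop N] with k hk
    refine lt_of_le_of_lt (ciSup_le fun s => ?_) hty
    by_cases hs : dist s x < δ
    · have : (0 : ℝ) ≤ k * |x - s| := by positivity
      linarith [hball hs]
    · have h1 : δ ≤ |x - s| := by
        rw [abs_sub_comm, ← Real.dist_eq]
        exact not_lt.1 hs
      have h2 : (N : ℝ) ≤ k := by exact_mod_cast hk
      have h3 : b - t < N * δ := (div_lt_iff₀ hδ).1 hN
      have h4 : (N : ℝ) * δ ≤ k * |x - s| := by gcongr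
      linarith [hb s]

/-- The truncation of `u` from below at `-M`, as a real-valued function. -/
noncomputable def truncBelow (u : ℂ → EReal) (M : ℝ) (z : ℂ) : ℝ :=
  (max (u z) ((-M : ℝ) : EReal)).toReal

lemma coe_truncBelow {u : ℂ → EReal} (M : ℝ) {z : ℂ} (hz : u z ≠ ⊤) :
    (truncBelow u M z : EReal) = max (u z) ((-M : ℝ) : EReal) := by
  refine EReal.coe_toReal ?_ ?_
  · rcases max_choice (u z) ((-M : ℝ) : EReal) with h | h <;> rw [h]
    · exact hz
    · exact EReal.coe_ne_top _
  · exact ne_bot_of_le_ne_bot (EReal.coe_ne_bot _) (le_max_right _ _)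

lemma neg_le_truncBelow {u : ℂ → EReal} (M : ℝ) {z : ℂ} (hz : u z ≠ ⊤) :
    -M ≤ truncBelow u M z := by
  rw [← EReal.coe_le_coe_iff, coe_truncBelow M hz]
  exact le_max_right _ _

lemma truncBelow_le {u : ℂ → EReal} {M B : ℝ} {z : ℂ} (hz : u z ≤ B) (hB : -M ≤ B) :
    truncBelow u M z ≤ B := by
  rw [← EReal.coe_le_coe_iff, coe_truncBelow M (ne_top_of_le_ne_top (EReal.coe_ne_top _) hz)]
  exact max_le hz (EReal.coe_le_coe_iff.2 hB)

lemma upperSemicontinuousOn_truncBelow {u : ℂ → EReal} {Ω : Set ℂ}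
    (hu : UpperSemicontinuousOn u Ω) (htop : ∀ z ∈ Ω, u z ≠ ⊤) (M : ℝ) :
    UpperSemicontinuousOn (truncBelow u M) Ω := by
  intro z hz y hy
  rw [← EReal.coe_lt_coe_iff, coe_truncBelow M (htop z hz), max_lt_iff] at hy
  filter_upwards [hu z hz y hy.1, self_mem_nhdsWithin] with w hw hwΩ
  rw [← EReal.coe_lt_coe_iff, coe_truncBelow M (htop w hwΩ), max_lt_iff]
  exact ⟨hw, hy.2⟩

lemma circle_mem_closedBall (c : ℂ) {r : ℝ} (hr : 0 ≤ r) (θ : ℝ) :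
    c + r * Complex.exp (θ * Complex.I) ∈ closedBall c r := by
  simp [abs_of_nonneg hr, Complex.norm_exp_ofReal_mul_I]

/-- The truncations of `u` satisfy the sub-mean value inequality in integral form. -/
lemma truncBelow_le_circle_mean {u : ℂ → EReal} {Ω : Set ℂ}
    (hu : UpperSemicontinuousOn u Ω) (htop : ∀ z ∈ Ω, u z ≠ ⊤) (hsub : SubmeanOn u Ω)
    {c : ℂ} {r B M : ℝ} (hr : 0 < r) (hcr : closedBall c r ⊆ Ω)
    (hB : ∀ z ∈ closedBall c r, u z ≤ (B : EReal)) (hMB : -M ≤ B) :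
    truncBelow u M c ≤ (2 * Real.pi)⁻¹ *
      ∫ θ in (0 : ℝ)..(2 * Real.pi), truncBelow u M (c + r * Complex.exp (θ * Complex.I)) := by
  have hmem := circle_mem_closedBall c hr.le
  set h : ℝ → ℝ := fun θ => truncBelow u M (c + r * Complex.exp (θ * Complex.I)) with hdef
  have hcont : Continuous fun θ : ℝ => c + r * Complex.exp (θ * Complex.I) := by fun_prop
  have husc : UpperSemicontinuous h := by
    intro θ y hy
    have h1 := upperSemicontinuousOn_truncBelow hu htop M _ (hcr (hmem θ)) y hy
    have h2 : Tendsto (fun θ : ℝ => c + r * Complex.exp (θ * Complex.I)) (nhds θ)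
        (nhdsWithin (c + r * Complex.exp (θ * Complex.I)) Ω) :=
      tendsto_nhdsWithin_iff.2 ⟨hcont.tendsto θ, Eventually.of_forall fun t => hcr (hmem t)⟩
    exact h2.eventually h1
  have hlo : ∀ θ, -M ≤ h θ := fun θ => neg_le_truncBelow M (htop _ (hcr (hmem θ)))
  have hhi : ∀ θ, h θ ≤ B := fun θ => truncBelow_le (hB _ (hmem θ)) hMB
  obtain ⟨φ, hφc, hφ, hφlim⟩ := husc.exists_continuous_majorants hhi
  have hpi : (0 : ℝ) < 2 * Real.pi := by positivity
  have key : ∀ k, truncBelow u M c ≤ (2 * Real.pi)⁻¹ * ∫ θ in (0 : ℝ)..(2 * Real.pi), φ k θ := by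
    intro k
    rw [← EReal.coe_le_coe_iff, coe_truncBelow M (htop c (hcr (mem_closedBall_self hr.le)))]
    refine max_le (hsub c r hr hcr (φ k) (hφc k) fun θ => ?_) (EReal.coe_le_coe_iff.2 ?_)
    · refine le_trans ?_ (EReal.coe_le_coe_iff.2 (hφ k θ).1)
      rw [hdef, coe_truncBelow M (htop _ (hcr (hmem θ)))]
      exact le_max_left _ _
    · have h1 : ∫ _ in (0 : ℝ)..(2 * Real.pi), -M ≤ ∫ θ in (0 : ℝ)..(2 * Real.pi), φ k θ :=
        intervalIntegral.integral_mono_on hpi.le (by simp) ((hφc k).intervalIntegrable _ _)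
          fun θ _ => (hlo θ).trans (hφ k θ).1
      rw [intervalIntegral.integral_const, smul_eq_mul, sub_zero] at h1
      rw [inv_mul_eq_div, le_div_iff₀ hpi]
      linarith
  refine ge_of_tendsto' (x := atTop) (Tendsto.const_mul _ ?_) key
  refine intervalIntegral.tendsto_integral_filter_of_dominated_convergence (fun _ => |M| + |B|)
    (Eventually.of_forall fun k => (hφc k).aestronglyMeasurable)
    (Eventually.of_forall fun k => Eventually.of_forall fun θ _ => ?_) (by simp)
    (Eventually.of_forall fun θ _ => hφlim θ)
  rw [Real.norm_eq_abs, abs_le]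
  have h1 := hlo θ
  have h2 := hφ k θ
  constructor
  · linarith [le_abs_self M, abs_nonneg B]
  · linarith [le_abs_self B, abs_nonneg M]

lemma measurableSet_eq_bot {u : ℂ → EReal} {Ω : Set ℂ} (hΩ : IsOpen Ω)
    (hu : UpperSemicontinuousOn u Ω) : MeasurableSet {z ∈ Ω | u z = ⊥} := by
  have h1 : {z ∈ Ω | u z = ⊥} = ⋂ n : ℕ, {z ∈ Ω | u z < ((-n : ℝ) : EReal)} := by
    ext z
    simp only [mem_ofPred_eq, mem_iInter]
    refine ⟨fun h n => ⟨h.1, h.2 ▸ EReal.bot_lt_coe _⟩, fun h => ⟨(h 0).1, ?_⟩⟩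
    rw [EReal.eq_bot_iff_forall_lt]
    intro y
    obtain ⟨n, hn⟩ := exists_nat_gt (-y)
    exact (h n).2.trans (EReal.coe_lt_coe_iff.2 (by linarith))
  rw [h1]
  refine MeasurableSet.iInter fun n => IsOpen.measurableSet ?_
  rw [isOpen_iff_mem_nhds]
  rintro z ⟨hz, hlt⟩
  have := hu z hz _ hlt
  rw [hΩ.nhdsWithin_eq hz] at this
  filter_upwards [this, hΩ.mem_nhds hz] with w h1 h2 using ⟨h2, h1⟩

lemma exists_real_bound {u : ℂ → EReal} {K : Set ℂ} (hK : IsCompact K)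
    (hu : UpperSemicontinuousOn u K) (htop : ∀ z ∈ K, u z ≠ ⊤) :
    ∃ B : ℝ, ∀ z ∈ K, u z ≤ (B : EReal) := by
  rcases K.eq_empty_or_nonempty with rfl | hne
  · exact ⟨0, by simp⟩
  · obtain ⟨x, hx, hmax⟩ := hu.exists_isMaxOn hne hK
    obtain ⟨B, hB⟩ : ∃ B : ℝ, u x ≤ (B : EReal) :=
      ⟨(u x).toReal, EReal.le_coe_toReal (htop x hx)⟩
    exact ⟨B, fun z hz => (hmax hz).trans hB⟩

lemma truncBelow_eq_of_eq_bot {u : ℂ → EReal} (M : ℝ) {z : ℂ} (hz : u z = ⊥) :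
    truncBelow u M z = -M := by
  simp [truncBelow, hz, -EReal.coe_neg]

/-- A subharmonic function which is finite at `c` is finite almost everywhere on the circles
around `c`. -/
lemma volume_circle_eq_bot_eq_zero {u : ℂ → EReal} {Ω : Set ℂ} (hΩ : IsOpen Ω)
    (hu : UpperSemicontinuousOn u Ω) (htop : ∀ z ∈ Ω, u z ≠ ⊤) (hsub : SubmeanOn u Ω)
    {c : ℂ} {r : ℝ} (hr : 0 < r) (hcr : closedBall c r ⊆ Ω) (hc : u c ≠ ⊥) :
    volume {θ ∈ Ioc (-Real.pi) Real.pi | u (c + r * Complex.exp (θ * Complex.I)) = ⊥} = 0 := by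
  have hmem := circle_mem_closedBall c hr.le
  obtain ⟨B, hB⟩ := exists_real_bound (isCompact_closedBall c r) (hu.mono hcr)
    fun z hz => htop z (hcr hz)
  have hcont : Continuous fun θ : ℝ => c + r * Complex.exp (θ * Complex.I) := by fun_prop
  set T := {θ ∈ Ioc (-Real.pi) Real.pi | u (c + r * Complex.exp (θ * Complex.I)) = ⊥} with hT
  have hTm : MeasurableSet T := by
    have := measurableSet_Ioc (a := -Real.pi) (b := Real.pi) |>.inter
      (hcont.measurable (measurableSet_eq_bot hΩ hu))
    convert this using 1
    ext θ
    simp [hT, hcr (hmem θ)]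
  have hTfin : volume T ≠ ⊤ := measure_ne_top_of_subset (fun θ hθ => hθ.1)
    (by simp : volume (Ioc (-Real.pi) Real.pi) ≠ ⊤)
  have hpi : (0 : ℝ) < 2 * Real.pi := by positivity
  have key : ∀ M : ℝ, -M ≤ B →
      (u c).toReal ≤ (2 * Real.pi)⁻¹ * (2 * Real.pi * B - (B + M) * volume.real T) := by
    intro M hM
    have hcΩ := hcr (mem_closedBall_self hr.le)
    have h1 : (u c).toReal ≤ truncBelow u M c := by
      rw [← EReal.coe_le_coe_iff, coe_truncBelow M (htop c hcΩ),
        EReal.coe_toReal (htop c hcΩ) hc]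
      exact le_max_left _ _
    refine h1.trans ((truncBelow_le_circle_mean hu htop hsub hr hcr hB hM).trans ?_)
    have hper : Function.Periodic
        (fun θ : ℝ => truncBelow u M (c + r * Complex.exp (θ * Complex.I))) (2 * Real.pi) := by
      intro θ
      have : Complex.exp (((θ + 2 * Real.pi : ℝ) : ℂ) * Complex.I)
          = Complex.exp (θ * Complex.I) := by
        rw [← Complex.exp_periodic (θ * Complex.I)]
        congr 1
        push_cast
        ring
      simp only [this]
    have hshift := hper.intervalIntegral_add_eq 0 (-Real.pi)
    rw [zero_add, show -Real.pi + 2 * Real.pi = Real.pi by ring] at hshift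
    rw [hshift, intervalIntegral.integral_of_le (by linarith [Real.pi_pos])]
    gcongr
    have hint : IntegrableOn (fun θ : ℝ => B - T.indicator (fun _ => B + M) θ)
        (Ioc (-Real.pi) Real.pi) :=
      (integrable_const B).sub ((integrable_const (B + M)).indicator hTm)
    have h2 : ∫ θ in Ioc (-Real.pi) Real.pi, truncBelow u M (c + r * Complex.exp (θ * Complex.I))
        ≤ ∫ θ in Ioc (-Real.pi) Real.pi, (B - T.indicator (fun _ => B + M) θ) := by
      by_cases hi : IntegrableOn (fun θ : ℝ => truncBelow u M (c + r * Complex.exp (θ * Complex.I)))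
          (Ioc (-Real.pi) Real.pi)
      · refine setIntegral_mono_on hi hint measurableSet_Ioc fun θ hθ => ?_
        by_cases hθT : θ ∈ T
        · rw [truncBelow_eq_of_eq_bot M hθT.2, indicator_of_mem hθT]
          linarith
        · rw [indicator_of_notMem hθT, sub_zero]
          exact truncBelow_le (hB _ (hmem θ)) hM
      · exfalso
        apply hi
        have husc := upperSemicontinuousOn_truncBelow hu htop M
        have : UpperSemicontinuous
            fun θ : ℝ => truncBelow u M (c + r * Complex.exp (θ * Complex.I)) := by
          intro θ y hy
          have h2 : Tendsto (fun θ : ℝ => c + r * Complex.exp (θ * Complex.I)) (nhds θ)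
              (nhdsWithin (c + r * Complex.exp (θ * Complex.I)) Ω) :=
            tendsto_nhdsWithin_iff.2 ⟨hcont.tendsto θ, Eventually.of_forall fun t => hcr (hmem t)⟩
          exact h2.eventually (husc _ (hcr (hmem θ)) y hy)
        refine Integrable.of_bound this.measurable.aestronglyMeasurable (|M| + |B|)
          (Eventually.of_forall fun θ => ?_)
        rw [Real.norm_eq_abs, abs_le]
        have h3 := neg_le_truncBelow M (htop _ (hcr (hmem θ)))
        have h4 := truncBelow_le (hB _ (hmem θ)) hM
        constructor
        · linarith [le_abs_self M, abs_nonneg B]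
        · linarith [le_abs_self B, abs_nonneg M]
    refine h2.trans (le_of_eq ?_)
    have hTsub : T ∩ Ioc (-Real.pi) Real.pi = T := inter_eq_left.2 fun θ hθ => hθ.1
    rw [integral_sub (integrable_const B) ((integrable_const (B + M)).indicator hTm),
      integral_indicator hTm, Measure.restrict_restrict hTm, hTsub]
    simp only [integral_const, measureReal_restrict_apply_univ, smul_eq_mul, Real.volume_real_Ioc]
    rw [max_eq_left (by linarith [Real.pi_pos])]
    ring
  by_contra hne
  have hpos : 0 < volume.real T := ENNReal.toReal_pos hne hTfin
  set x := (u c).toReal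
  obtain ⟨M, hM⟩ := exists_gt (max (-B) ((2 * Real.pi * B - 2 * Real.pi * x) / volume.real T - B))
  rw [max_lt_iff] at hM
  have h1 := key M (by linarith [hM.1])
  have h2 : (2 * Real.pi * B - 2 * Real.pi * x) / volume.real T < B + M := by linarith [hM.2]
  rw [div_lt_iff₀ hpos] at h2
  rw [inv_mul_eq_div, le_div_iff₀ hpi] at h1
  linarith

lemma volume_ball_eq_bot_eq_zero {u : ℂ → EReal} {Ω : Set ℂ} (hΩ : IsOpen Ω)
    (hu : UpperSemicontinuousOn u Ω) (htop : ∀ z ∈ Ω, u z ≠ ⊤) (hsub : SubmeanOn u Ω)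
    {c : ℂ} {R : ℝ} (hcR : ball c R ⊆ Ω) (hc : u c ≠ ⊥) :
    volume {z ∈ ball c R | u z = ⊥} = 0 := by
  set N := {z ∈ ball c R | u z = ⊥} with hN
  have hNm : MeasurableSet N := by
    convert measurableSet_ball (x := c) (ε := R) |>.inter (measurableSet_eq_bot hΩ hu) using 1
    ext z
    simp only [hN, mem_ofPred_eq, mem_inter_iff]
    exact ⟨fun h => ⟨h.1, hcR h.1, h.2⟩, fun h => ⟨h.1, h.2.2⟩⟩
  have hm : Measurable fun w : ℂ => N.indicator (1 : ℂ → ENNReal) (c + w) :=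
    (measurable_one.indicator hNm).comp (measurable_const_add c)
  have h1 : volume N = ∫⁻ w : ℂ, N.indicator (1 : ℂ → ENNReal) (c + w) := by
    rw [lintegral_add_left_eq_self (fun w => N.indicator (1 : ℂ → ENNReal) w) c,
      lintegral_indicator_one hNm]
  have hpm : Measurable fun p : ℝ × ℝ =>
      ENNReal.ofReal p.1 • N.indicator (1 : ℂ → ENNReal) (c + Complex.polarCoord.symm p) := by
    have h2 := hm.comp Complex.measurableEquivRealProd.symm.measurable |>.comp
      continuous_polarCoord_symm.measurable
    exact (ENNReal.measurable_ofReal.comp measurable_fst).smul h2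
  have hslice : ∀ r ∈ Ioi (0 : ℝ), ∫⁻ θ in Ioo (-Real.pi) Real.pi,
      ENNReal.ofReal r • N.indicator (1 : ℂ → ENNReal) (c + Complex.polarCoord.symm (r, θ)) = 0 := by
    intro r hr
    have hr : 0 < r := hr
    have hpol : ∀ θ : ℝ, Complex.polarCoord.symm (r, θ) = r * Complex.exp (θ * Complex.I) := by
      intro θ
      rw [Complex.polarCoord_symm_apply, Complex.exp_mul_I]
      simp
    simp only [hpol]
    by_cases hrR : r < R
    · have hz := volume_circle_eq_bot_eq_zero hΩ hu htop hsub hr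
        ((closedBall_subset_ball hrR).trans hcR) hc
      have hae : (fun θ : ℝ => ENNReal.ofReal r •
          N.indicator (1 : ℂ → ENNReal) (c + r * Complex.exp (θ * Complex.I)))
            =ᵐ[volume.restrict (Ioo (-Real.pi) Real.pi)] fun _ => 0 := by
        refine (ae_restrict_iff' measurableSet_Ioo).2 ?_
        filter_upwards [compl_mem_ae_iff.2 hz] with θ hθ hmem
        rw [indicator_of_notMem (fun h => hθ ⟨Ioo_subset_Ioc_self hmem, h.2⟩), smul_zero]
      rw [lintegral_congr_ae hae, lintegral_zero]
    · have : ∀ θ : ℝ, c + r * Complex.exp (θ * Complex.I) ∉ N := by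
        rintro θ ⟨h, -⟩
        simp [abs_of_pos hr, Complex.norm_exp_ofReal_mul_I] at h
        exact hrR h
      simp [this]
  rw [h1, ← Complex.lintegral_comp_polarCoord_symm, polarCoord_target,
    Measure.volume_eq_prod, ← Measure.prod_restrict, lintegral_prod _ hpm.aemeasurable,
    setLIntegral_congr_fun measurableSet_Ioi hslice, lintegral_zero]

lemma volume_sep_eq_zero_mono {u : ℂ → EReal} {s t : Set ℂ} (hst : s ⊆ t)
    (h0 : volume {w ∈ t | u w = ⊥} = 0) : volume {w ∈ s | u w = ⊥} = 0 :=
  measure_mono_null (t := {w ∈ t | u w = ⊥}) (fun _ hx => ⟨hst hx.1, hx.2⟩) h0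

/-- The `-∞`-set of a subharmonic function is a null set. -/
lemma SubharmonicOn.volume_eq_bot {u : ℂ → EReal} {Ω : Set ℂ} (h : SubharmonicOn u Ω) :
    volume {z ∈ Ω | u z = ⊥} = 0 := by
  obtain ⟨hΩ, hu, htop, hbot, hsub⟩ := h
  set A := {z ∈ Ω | ∃ r > 0, volume {w ∈ ball z r | u w = ⊥} = 0} with hA
  have hAof : ∀ z ∈ Ω, u z ≠ ⊥ → z ∈ A := fun z hz hne => by
    obtain ⟨r, hr, hsubs⟩ := Metric.isOpen_iff.1 hΩ z hz
    exact ⟨hz, r, hr, volume_ball_eq_bot_eq_zero hΩ hu htop hsub hsubs hne⟩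
  have hAopen : IsOpen A := by
    rw [Metric.isOpen_iff]
    rintro z ⟨hz, r, hr, h0⟩
    obtain ⟨s, hs, hsubs⟩ := Metric.isOpen_iff.1 hΩ z hz
    refine ⟨min s (r / 2), lt_min hs (half_pos hr), fun w hw => ?_⟩
    have hw1 : dist w z < r / 2 := (mem_ball.1 hw).trans_le (min_le_right _ _)
    refine ⟨hsubs (ball_subset_ball (min_le_left _ _) hw), r / 2, half_pos hr,
      volume_sep_eq_zero_mono (ball_subset_ball' (by linarith)) h0⟩
  have hBopen : IsOpen (Ω \ A) := by
    rw [Metric.isOpen_iff]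
    rintro z ⟨hz, hzA⟩
    obtain ⟨s, hs, hsubs⟩ := Metric.isOpen_iff.1 hΩ z hz
    have hbot : ∀ w ∈ ball z (s / 2), u w = ⊥ := by
      intro w hw
      by_contra hne
      have hw' : dist w z < s / 2 := hw
      have h0 := volume_ball_eq_bot_eq_zero (c := w) (R := s / 2) hΩ hu htop hsub
        ((ball_subset_ball' (by linarith)).trans hsubs) hne
      refine hzA ⟨hz, s / 2 - dist w z, by linarith,
        volume_sep_eq_zero_mono (ball_subset_ball' ?_) h0⟩
      rw [dist_comm z w]
      linarith
    refine ⟨s / 2, half_pos hs, fun w hw => ⟨hsubs (ball_subset_ball (by linarith) hw), ?_⟩⟩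
    rintro ⟨-, r, hr, h0⟩
    have hw' : dist w z < s / 2 := hw
    refine (measure_ball_pos volume w (lt_min hr (by linarith : 0 < s / 2 - dist w z))).ne' ?_
    refine measure_mono_null (t := {x ∈ ball w r | u x = ⊥})
      (fun x hx => ⟨ball_subset_ball (min_le_left _ _) hx, hbot x ?_⟩) h0
    exact ball_subset_ball' (by linarith [min_le_right r (s / 2 - dist w z)]) hx
  have hall : Ω ⊆ A := by
    intro z hz
    obtain ⟨w, hw, hne⟩ := hbot z hz
    have hwΩ := connectedComponentIn_subset Ω z hw
    have hcov : connectedComponentIn Ω z ⊆ A ∪ Ω \ A := fun x hx => by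
      by_cases hxA : x ∈ A
      · exact Or.inl hxA
      · exact Or.inr ⟨connectedComponentIn_subset Ω z hx, hxA⟩
    exact isPreconnected_connectedComponentIn.subset_left_of_subset_union hAopen hBopen
      disjoint_sdiff_right hcov ⟨w, hw, hAof w hwΩ hne⟩ (mem_connectedComponentIn hz)
  refine measure_null_of_locally_null _ fun z hz => ?_
  obtain ⟨-, r, hr, h0⟩ := hall hz.1
  exact ⟨_, inter_mem_nhdsWithin _ (ball_mem_nhds z hr),
    measure_mono_null (t := {x ∈ ball z r | u x = ⊥}) (fun x hx => ⟨hx.2, hx.1.2⟩) h0⟩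

/-- The Laplacian of a function on the complex plane, in terms of iterated derivatives. -/
noncomputable def lapl (f : ℂ → ℝ) (z : ℂ) : ℝ :=
  fderiv ℝ (fun w => fderiv ℝ f w 1) z 1 + fderiv ℝ (fun w => fderiv ℝ f w Complex.I) z Complex.I

/-- Second order Taylor estimate. -/
lemma taylor_two_bound {f : ℂ → ℝ} (hf : ContDiff ℝ 2 f) (z : ℂ) {ε : ℝ} (hε : 0 < ε) :
    ∃ δ > 0, ∀ h : ℂ, ‖h‖ < δ →
      |f (z + h) - f z - fderiv ℝ f z h - 2⁻¹ * fderiv ℝ (fderiv ℝ f) z h h| ≤ ε * ‖h‖ ^ 2 := by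
  have hd : Differentiable ℝ f := hf.differentiable (by norm_num)
  have hd2 : Differentiable ℝ (fderiv ℝ f) :=
    (hf.fderiv_right (m := 1) (by norm_num)).differentiable (by norm_num)
  have h1 := (hd2 z).hasFDerivAt.isLittleO
  rw [Asymptotics.isLittleO_iff] at h1
  obtain ⟨δ, hδ, hb⟩ := Metric.eventually_nhds_iff.1 (h1 hε)
  refine ⟨δ, hδ, fun h hh => ?_⟩
  set A := fderiv ℝ (fderiv ℝ f) z
  let R : ℝ → ℝ := fun t => f (z + t • h) - t * fderiv ℝ f z h - 2⁻¹ * t ^ 2 * A h h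
  have hR : ∀ t : ℝ, HasDerivAt R
      (fderiv ℝ f (z + t • h) h - fderiv ℝ f z h - t * A h h) t := by
    intro t
    have e1 : HasDerivAt (fun t : ℝ => z + t • h) h t := by
      simpa using ((hasDerivAt_id t).smul_const h).const_add z
    have e2 := (hd (z + t • h)).hasFDerivAt.comp_hasDerivAt t e1
    have e3 := (hasDerivAt_id t).mul_const (fderiv ℝ f z h)
    have e4 := ((hasDerivAt_pow 2 t).const_mul (2⁻¹ : ℝ)).mul_const (A h h)
    refine ((e2.sub e3).sub e4).congr_deriv ?_
    simp only [one_mul, Nat.cast_ofNat, pow_one, Nat.reduceSub]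
    ring
  have hbound : ∀ t ∈ Ico (0 : ℝ) 1,
      ‖fderiv ℝ f (z + t • h) h - fderiv ℝ f z h - t * A h h‖ ≤ ε * ‖h‖ ^ 2 := by
    intro t ht
    have hth : ‖t • h‖ ≤ ‖h‖ := by
      rw [norm_smul, Real.norm_of_nonneg ht.1]
      nlinarith [norm_nonneg h, ht.2]
    have h2 : dist (z + t • h) z < δ := by simpa [dist_eq_norm] using hth.trans_lt hh
    have h3 := hb h2
    rw [add_sub_cancel_left] at h3
    have h4 := (fderiv ℝ f (z + t • h) - fderiv ℝ f z - A (t • h)).le_of_opNorm_le h3 h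
    simp only [sub_apply, map_smul, smul_apply,
      smul_eq_mul] at h4
    refine h4.trans ?_
    rw [pow_two, ← mul_assoc]
    gcongr
  have := norm_image_sub_le_of_norm_deriv_le_segment_01' (f := R)
    (fun t _ => (hR t).hasDerivWithinAt) hbound
  simp only [R, one_smul, zero_smul, add_zero, Real.norm_eq_abs] at this
  convert this using 2
  ring

lemma lapl_eq {f : ℂ → ℝ} (hf : ContDiff ℝ 2 f) (z : ℂ) :
    lapl f z = fderiv ℝ (fderiv ℝ f) z 1 1 + fderiv ℝ (fderiv ℝ f) z Complex.I Complex.I := by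
  have hd2 : Differentiable ℝ (fderiv ℝ f) :=
    (hf.fderiv_right (m := 1) (by norm_num)).differentiable (by norm_num)
  unfold lapl
  rw [fderiv_clm_apply (hd2 z) (differentiableAt_const _),
    fderiv_clm_apply (hd2 z) (differentiableAt_const _)]
  simp

/-- A smooth function satisfying the sub-mean value inequality has nonnegative Laplacian. -/
lemma lapl_nonneg {f : ℂ → ℝ} (hf : ContDiff ℝ 2 f) {z : ℂ} {δ : ℝ} (hδ : 0 < δ)
    (hmean : ∀ r, 0 < r → r < δ → f z ≤ (2 * Real.pi)⁻¹ *
      ∫ θ in (0 : ℝ)..(2 * Real.pi), f (z + r * Complex.exp (θ * Complex.I))) :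
    0 ≤ lapl f z := by
  rw [lapl_eq hf]
  set A := fderiv ℝ (fderiv ℝ f) z
  set L := fderiv ℝ f z
  refine le_of_forall_pos_le_add fun ε hε => ?_
  obtain ⟨δ', hδ', hT⟩ := taylor_two_bound hf z (ε := ε / 4) (by positivity)
  obtain ⟨r, hr, hrδ⟩ := exists_between (lt_min hδ hδ')
  have hpi : (0 : ℝ) < 2 * Real.pi := by positivity
  have hcs : ∀ θ : ℝ, (r : ℂ) * Complex.exp (θ * Complex.I)
      = (r * Real.cos θ) • (1 : ℂ) + (r * Real.sin θ) • Complex.I := by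
    intro θ
    rw [Complex.exp_mul_I]
    simp
    ring
  have hpt : ∀ θ : ℝ, f (z + r * Complex.exp (θ * Complex.I)) ≤ f z + ε / 4 * r ^ 2
      + (r * Real.cos θ * L 1 + r * Real.sin θ * L Complex.I)
      + 2⁻¹ * (r ^ 2 * (Real.cos θ ^ 2 * A 1 1 + Real.cos θ * Real.sin θ * (A 1 Complex.I)
        + Real.sin θ * Real.cos θ * (A Complex.I 1) + Real.sin θ ^ 2 * A Complex.I Complex.I)) := by
    intro θ
    have hn : ‖(r : ℂ) * Complex.exp (θ * Complex.I)‖ = r := by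
      simp [abs_of_pos hr, Complex.norm_exp_ofReal_mul_I]
    have h1 := (abs_le.1 (hT (r * Complex.exp (θ * Complex.I))
      (hn.trans_lt (hrδ.trans_le (min_le_right _ _))))).2
    rw [hn] at h1
    have h2 : L (r * Complex.exp (θ * Complex.I))
        = r * Real.cos θ * L 1 + r * Real.sin θ * L Complex.I := by
      rw [hcs]
      simp only [map_add, map_smul, smul_eq_mul]
    have h3 : A (r * Complex.exp (θ * Complex.I)) (r * Complex.exp (θ * Complex.I))
        = r ^ 2 * (Real.cos θ ^ 2 * A 1 1 + Real.cos θ * Real.sin θ * (A 1 Complex.I)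
        + Real.sin θ * Real.cos θ * (A Complex.I 1)
        + Real.sin θ ^ 2 * A Complex.I Complex.I) := by
      rw [hcs]
      simp only [map_add, map_smul, smul_eq_mul, add_apply,
        smul_apply]
      ring
    rw [← h2, ← h3]
    linarith
  have hfc : Continuous f := hf.continuous
  have h1 := intervalIntegral.integral_mono_on (μ := volume) hpi.le
    (Continuous.intervalIntegrable (by fun_prop) _ _)
    (Continuous.intervalIntegrable (by fun_prop) _ _) fun θ _ => hpt θ
  have h2 := hmean r hr (hrδ.trans_le (min_le_left _ _))
  have hint : ∫ θ in (0 : ℝ)..(2 * Real.pi), (f z + ε / 4 * r ^ 2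
      + (r * Real.cos θ * L 1 + r * Real.sin θ * L Complex.I)
      + 2⁻¹ * (r ^ 2 * (Real.cos θ ^ 2 * A 1 1 + Real.cos θ * Real.sin θ * (A 1 Complex.I)
        + Real.sin θ * Real.cos θ * (A Complex.I 1) + Real.sin θ ^ 2 * A Complex.I Complex.I)))
      = 2 * Real.pi * (f z + ε / 4 * r ^ 2)
        + 2⁻¹ * (r ^ 2 * (Real.pi * A 1 1 + Real.pi * A Complex.I Complex.I)) := by
    have hprim : ∀ θ ∈ uIcc 0 (2 * Real.pi), HasDerivAt (fun θ : ℝ => θ * (f z + ε / 4 * r ^ 2)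
        + (r * Real.sin θ * L 1 - r * Real.cos θ * L Complex.I)
        + 2⁻¹ * (r ^ 2 * ((θ + Real.sin θ * Real.cos θ) / 2 * A 1 1
          + Real.sin θ ^ 2 / 2 * (A 1 Complex.I) + Real.sin θ ^ 2 / 2 * (A Complex.I 1)
          + (θ - Real.sin θ * Real.cos θ) / 2 * A Complex.I Complex.I))) (f z + ε / 4 * r ^ 2
      + (r * Real.cos θ * L 1 + r * Real.sin θ * L Complex.I)
      + 2⁻¹ * (r ^ 2 * (Real.cos θ ^ 2 * A 1 1 + Real.cos θ * Real.sin θ * (A 1 Complex.I)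
        + Real.sin θ * Real.cos θ * (A Complex.I 1)
        + Real.sin θ ^ 2 * A Complex.I Complex.I))) θ := by
      intro θ _
      have hs := Real.hasDerivAt_sin θ
      have hc := Real.hasDerivAt_cos θ
      have hi := hasDerivAt_id θ
      have hsc := hs.mul hc
      have hss := (hs.pow 2).div_const 2
      refine (((hi.mul_const (f z + ε / 4 * r ^ 2)).add
        (((hs.const_mul r).mul_const (L 1)).sub ((hc.const_mul r).mul_const (L Complex.I)))).add
        (((((((hi.add hsc).div_const 2).mul_const (A 1 1)).add
          (hss.mul_const (A 1 Complex.I))).add (hss.mul_const (A Complex.I 1))).add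
          (((hi.sub hsc).div_const 2).mul_const (A Complex.I Complex.I))).const_mul
            (r ^ 2) |>.const_mul 2⁻¹)).congr_deriv ?_
      simp only [Nat.cast_ofNat]
      linear_combination (2⁻¹ * r ^ 2 * (A 1 1 - A Complex.I Complex.I)) / 2 *
        (-(Real.sin_sq_add_cos_sq θ)) +
        (2⁻¹ * r ^ 2 * (A Complex.I Complex.I)) * (-(Real.sin_sq_add_cos_sq θ))
    rw [intervalIntegral.integral_eq_sub_of_hasDerivAt hprim
      (Continuous.intervalIntegrable (by fun_prop) _ _)]
    simp
    ring
  rw [hint] at h1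
  rw [inv_mul_eq_div, le_div_iff₀ hpi] at h2
  have h3 : 0 ≤ (2⁻¹ * Real.pi * r ^ 2) *
      (A 1 1 + A Complex.I Complex.I + ε) := by nlinarith
  exact (mul_nonneg_iff_of_pos_left (by positivity)).1 h3

/-- Twice the Wirtinger derivative `∂/∂z̄` of a real-valued function. -/
noncomputable def dbar (φ : ℂ → ℝ) (z : ℂ) : ℂ :=
  (fderiv ℝ φ z 1 : ℂ) + Complex.I * (fderiv ℝ φ z Complex.I : ℂ)

section SmoothCalculus

open scoped ContDiff

lemma ContDiff.fderiv_apply_const {φ : ℂ → ℝ} (hφ : ContDiff ℝ ∞ φ) (v : ℂ) :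
    ContDiff ℝ ∞ fun z => fderiv ℝ φ z v :=
  (hφ.fderiv_right (m := ∞) (by simp)).clm_apply contDiff_const

lemma HasCompactSupport.fderiv_apply_const {φ : ℂ → ℝ} (hφ : HasCompactSupport φ) (v : ℂ) :
    HasCompactSupport fun z => fderiv ℝ φ z v :=
  hφ.fderiv_apply ℝ v

lemma continuous_dbar {φ : ℂ → ℝ} (hφ : ContDiff ℝ ∞ φ) : Continuous (dbar φ) := by
  have h1 := (hφ.fderiv_apply_const 1).continuous
  have h2 := (hφ.fderiv_apply_const Complex.I).continuous
  unfold dbar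
  fun_prop

lemma continuous_lapl {φ : ℂ → ℝ} (hφ : ContDiff ℝ ∞ φ) : Continuous (lapl φ) :=
  (((hφ.fderiv_apply_const 1).fderiv_apply_const 1).add
    ((hφ.fderiv_apply_const Complex.I).fderiv_apply_const Complex.I)).continuous

lemma HasCompactSupport.dbar {φ : ℂ → ℝ} (hφ : HasCompactSupport φ) :
    HasCompactSupport (dbar φ) := by
  refine hφ.mono' fun z hz => ?_
  by_contra h
  have h1 : fderiv ℝ φ z = 0 := fderiv_of_notMem_tsupport ℝ h
  exact hz (by simp [_root_.dbar, h1])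

lemma lapl_of_notMem_tsupport {φ : ℂ → ℝ} {z : ℂ} (h : z ∉ tsupport φ) : lapl φ z = 0 := by
  have h1 : ∀ v, fderiv ℝ (fun w => fderiv ℝ φ w v) z = 0 := fun v => by
    refine fderiv_of_notMem_tsupport ℝ fun hz => h ?_
    exact tsupport_fderiv_apply_subset ℝ v hz
  simp [lapl, h1]

lemma dbar_of_notMem_tsupport {φ : ℂ → ℝ} {z : ℂ} (h : z ∉ tsupport φ) : dbar φ z = 0 := by
  simp [dbar, fderiv_of_notMem_tsupport ℝ h]

lemma dbar_mul {φ ψ : ℂ → ℝ} (hφ : ContDiff ℝ ∞ φ) (hψ : ContDiff ℝ ∞ ψ) (z : ℂ) :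
    dbar (fun w => φ w * ψ w) z = ψ z * dbar φ z + φ z * dbar ψ z := by
  have h := fderiv_fun_mul (hφ.differentiable (by simp) z) (hψ.differentiable (by simp) z)
  simp only [dbar, h, add_apply, smul_apply, smul_eq_mul]
  push_cast
  ring

lemma norm_dbar_sq (φ : ℂ → ℝ) (z : ℂ) :
    ‖dbar φ z‖ ^ 2 = fderiv ℝ φ z 1 ^ 2 + fderiv ℝ φ z Complex.I ^ 2 := by
  rw [← Complex.normSq_eq_norm_sq, Complex.normSq_apply]
  simp [dbar]
  ring

lemma integral_mul_fderiv_fderiv_comm {p q : ℂ → ℝ} (hp : ContDiff ℝ ∞ p)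
    (hpc : HasCompactSupport p) (hq : ContDiff ℝ ∞ q) (v : ℂ) :
    ∫ z, p z * fderiv ℝ (fun w => fderiv ℝ q w v) z v =
      ∫ z, q z * fderiv ℝ (fun w => fderiv ℝ p w v) z v := by
  have hp1 := hp.fderiv_apply_const v
  have hq1 := hq.fderiv_apply_const v
  have hp2 := hp1.fderiv_apply_const v
  have hq2 := hq1.fderiv_apply_const v
  have hpc1 := hpc.fderiv_apply_const v
  have hpc2 := hpc1.fderiv_apply_const v
  rw [integral_mul_fderiv_eq_neg_fderiv_mul_of_integrable,
    integral_mul_fderiv_eq_neg_fderiv_mul_of_integrable]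
  · simp only [mul_comm, neg_neg]
  · exact (hp2.continuous.mul hq.continuous).integrable_of_hasCompactSupport hpc2.mul_right
  · exact (hp1.continuous.mul hq1.continuous).integrable_of_hasCompactSupport hpc1.mul_right
  · exact (hp1.continuous.mul hq.continuous).integrable_of_hasCompactSupport hpc1.mul_right
  · exact fun z _ => hp1.differentiable (by simp) z
  · exact fun z _ => hq.differentiable (by simp) z
  · exact (hp1.continuous.mul hq1.continuous).integrable_of_hasCompactSupport hpc1.mul_right
  · exact (hp.continuous.mul hq2.continuous).integrable_of_hasCompactSupport hpc.mul_right
  · exact (hp.continuous.mul hq1.continuous).integrable_of_hasCompactSupport hpc.mul_right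
  · exact fun z _ => hp.differentiable (by simp) z
  · exact fun z _ => hq1.differentiable (by simp) z

lemma integral_mul_lapl_comm {p q : ℂ → ℝ} (hp : ContDiff ℝ ∞ p)
    (hpc : HasCompactSupport p) (hq : ContDiff ℝ ∞ q) :
    ∫ z, p z * lapl q z = ∫ z, q z * lapl p z := by
  have e1 := integral_mul_fderiv_fderiv_comm hp hpc hq 1
  have e2 := integral_mul_fderiv_fderiv_comm hp hpc hq Complex.I
  have i : ∀ v, Integrable fun z => p z * fderiv ℝ (fun w => fderiv ℝ q w v) z v := fun v =>
    (hp.continuous.mul ((hq.fderiv_apply_const v).fderiv_apply_const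
      v).continuous).integrable_of_hasCompactSupport hpc.mul_right
  have j : ∀ v, Integrable fun z => q z * fderiv ℝ (fun w => fderiv ℝ p w v) z v := fun v =>
    (hq.continuous.mul ((hp.fderiv_apply_const v).fderiv_apply_const
      v).continuous).integrable_of_hasCompactSupport
        ((hpc.fderiv_apply_const v).fderiv_apply_const v).mul_left
  simp only [lapl, mul_add]
  rw [integral_add (i 1) (i Complex.I), integral_add (j 1) (j Complex.I), e1, e2]

lemma lapl_half_sq {τ : ℂ → ℝ} (hτ : ContDiff ℝ ∞ τ) (z : ℂ) :
    lapl (fun w => 2⁻¹ * (τ w ^ 2 - 1)) z = τ z * lapl τ z + ‖dbar τ z‖ ^ 2 := by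
  have h1 : ∀ w, HasFDerivAt (fun w => 2⁻¹ * (τ w ^ 2 - 1)) (τ w • fderiv ℝ τ w) w := by
    intro w
    have := (((hτ.differentiable (by simp) w).hasFDerivAt.pow 2).sub_const 1).const_mul (2⁻¹ : ℝ)
    refine this.congr_fderiv ?_
    ext v
    simp
    ring
  have h2 : ∀ v, fderiv ℝ (fun w => fderiv ℝ (fun w => 2⁻¹ * (τ w ^ 2 - 1)) w v) z v
      = τ z * fderiv ℝ (fun w => fderiv ℝ τ w v) z v + fderiv ℝ τ z v ^ 2 := by
    intro v
    have e : (fun w => fderiv ℝ (fun w => 2⁻¹ * (τ w ^ 2 - 1)) w v)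
        = fun w => τ w * fderiv ℝ τ w v := by
      ext w
      rw [(h1 w).fderiv]
      simp
    rw [e, fderiv_fun_mul (hτ.differentiable (by simp) z)
      ((hτ.fderiv_apply_const v).differentiable (by simp) z)]
    simp
    ring
  rw [norm_dbar_sq, lapl, h2, h2, lapl]
  ring

/-- Caccioppoli-type energy estimate for smooth subharmonic functions with values in `[0, 1]`. -/
lemma integral_mul_norm_dbar_sq_le {p τ : ℂ → ℝ} (hp : ContDiff ℝ ∞ p) (hpc : HasCompactSupport p)
    (hp0 : ∀ z, 0 ≤ p z) (hτ : ContDiff ℝ ∞ τ) (hτ0 : ∀ z, 0 ≤ τ z) (hτ1 : ∀ z, τ z ≤ 1)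
    (hlapl : ∀ z ∈ tsupport p, 0 ≤ lapl τ z) :
    ∫ z, p z * ‖dbar τ z‖ ^ 2 ≤ ∫ z, (1 - τ z) * |lapl p z| := by
  have hq : ContDiff ℝ ∞ fun w => 2⁻¹ * (τ w ^ 2 - 1) := by fun_prop
  have hd := continuous_dbar hτ
  have hlp := continuous_lapl hp
  have hlpc : HasCompactSupport (lapl p) :=
    hpc.mono' fun z hz => by_contra fun h => hz (lapl_of_notMem_tsupport h)
  calc ∫ z, p z * ‖dbar τ z‖ ^ 2
      ≤ ∫ z, p z * lapl (fun w => 2⁻¹ * (τ w ^ 2 - 1)) z := by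
        refine integral_mono
          ((hp.continuous.mul (hd.norm.pow 2)).integrable_of_hasCompactSupport hpc.mul_right)
          ((hp.continuous.mul (continuous_lapl hq)).integrable_of_hasCompactSupport hpc.mul_right)
          fun z => ?_
        simp only [lapl_half_sq hτ z]
        by_cases hz : z ∈ tsupport p
        · have := mul_nonneg (hp0 z) (mul_nonneg (hτ0 z) (hlapl z hz))
          nlinarith
        · simp [image_eq_zero_of_notMem_tsupport hz]
    _ = ∫ z, 2⁻¹ * (τ z ^ 2 - 1) * lapl p z := integral_mul_lapl_comm hp hpc hq
    _ ≤ ∫ z, (1 - τ z) * |lapl p z| := by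
        refine integral_mono
          ((hq.continuous.mul hlp).integrable_of_hasCompactSupport hlpc.mul_left)
          (((continuous_const.sub hτ.continuous).mul hlp.abs).integrable_of_hasCompactSupport
            (HasCompactSupport.mul_left (hlpc.comp_left abs_zero))) fun z => ?_
        have h0 := hτ0 z
        have h1 := hτ1 z
        have h2 : |2⁻¹ * (τ z ^ 2 - 1)| ≤ 1 - τ z := by
          rw [abs_le]
          constructor <;> nlinarith
        calc 2⁻¹ * (τ z ^ 2 - 1) * lapl p z ≤ |2⁻¹ * (τ z ^ 2 - 1) * lapl p z| := le_abs_self _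
          _ = |2⁻¹ * (τ z ^ 2 - 1)| * |lapl p z| := abs_mul _ _
          _ ≤ _ := by gcongr

/-- Holomorphic functions are annihilated weakly by `∂/∂z̄`. -/
lemma integral_dbar_mul_eq_zero {D : Set ℂ} (hD : IsOpen D) {f : ℂ → ℂ}
    (hf : DifferentiableOn ℂ f D) {φ : ℂ → ℝ} (hφ : ContDiff ℝ ∞ φ) (hφc : HasCompactSupport φ)
    (hφD : tsupport φ ⊆ D) : ∫ z, dbar φ z * f z = 0 := by
  have hfd : ∀ z ∈ D, ∀ v, fderiv ℝ f z v = v * deriv f z := by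
    intro z hz v
    have := (hf.differentiableAt (hD.mem_nhds hz)).hasDerivAt.hasFDerivAt.restrictScalars ℝ
    rw [this.fderiv]
    simp
  have hsupp : ∀ {ψ : ℂ → ℝ} {g : ℂ → ℂ}, Continuous ψ → tsupport ψ ⊆ tsupport φ →
      ContinuousOn g D → Integrable fun z => ψ z • g z := by
    intro ψ g hψ hψφ hg
    have hc : HasCompactSupport ψ := hφc.mono' ((subset_tsupport ψ).trans hψφ)
    refine Continuous.integrable_of_hasCompactSupport ?_ hc.smul_right
    refine continuous_of_tsupport fun z hz => ?_
    have hzψ : z ∈ tsupport ψ := closure_mono (Function.support_smul_subset_left ψ g) hz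
    exact hψ.continuousAt.smul (hg.continuousAt (hD.mem_nhds (hφD (hψφ hzψ))))
  have hderiv : ContinuousOn (deriv f) D := (hf.deriv hD).continuousOn
  have i0 : ∀ v, Integrable fun z => fderiv ℝ φ z v • f z := fun v =>
    hsupp (hφ.fderiv_apply_const v).continuous (tsupport_fderiv_apply_subset ℝ v) hf.continuousOn
  have i1 : ∀ v, Integrable fun z => φ z • fderiv ℝ f z v := fun v =>
    hsupp hφ.continuous subset_rfl
      ((continuousOn_const.mul hderiv).congr fun z hz => hfd z hz v)
  have key : ∀ v, ∫ z, φ z • fderiv ℝ f z v = - ∫ z, fderiv ℝ φ z v • f z := fun v =>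
    integral_smul_fderiv_eq_neg_fderiv_smul_of_integrable (i0 v) (i1 v)
      (hsupp hφ.continuous subset_rfl hf.continuousOn)
      (fun z _ => hφ.differentiable (by simp) z) fun z hz =>
        (hf.differentiableAt (hD.mem_nhds (hφD hz))).restrictScalars ℝ
  have hsum : ∫ z, dbar φ z * f z
      = (∫ z, fderiv ℝ φ z 1 • f z) + Complex.I * ∫ z, fderiv ℝ φ z Complex.I • f z := by
    rw [← integral_const_mul, ← integral_add (i0 1) ((i0 Complex.I).const_mul _)]
    refine integral_congr_ae (Eventually.of_forall fun z => ?_)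
    simp only [dbar, Complex.real_smul]
    ring
  have hzero : (∫ z, φ z • fderiv ℝ f z 1)
      + Complex.I * ∫ z, φ z • fderiv ℝ f z Complex.I = 0 := by
    rw [← integral_const_mul, ← integral_add (i1 1) ((i1 Complex.I).const_mul _)]
    refine integral_eq_zero_of_ae (Eventually.of_forall fun z => ?_)
    by_cases hz : z ∈ tsupport φ
    · simp only [hfd z (hφD hz), Complex.real_smul, Pi.zero_apply]
      linear_combination (φ z : ℂ) * deriv f z * Complex.I_mul_I
    · simp [image_eq_zero_of_notMem_tsupport hz]
  rw [key, key] at hzero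
  rw [hsum]
  linear_combination -hzero

end SmoothCalculus

section Mollification

open scoped ContDiff

/-- A bump function centred at `0` with outer radius `1 / (n + 1)`. -/
noncomputable def shrinkingBump (n : ℕ) : ContDiffBump (0 : ℂ) where
  rIn := 1 / (n + 1) / 2
  rOut := 1 / (n + 1)
  rIn_pos := by positivity
  rIn_lt_rOut := half_lt_self (by positivity)

lemma tendsto_shrinkingBump_rOut : Tendsto (fun n => (shrinkingBump n).rOut) atTop (nhds 0) :=
  tendsto_one_div_add_atTop_nhds_zero_nat

/-- Convolution with the normalised bump function of radius `1 / (n + 1)`. -/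
noncomputable def mollify {E : Type*} [NormedAddCommGroup E] [NormedSpace ℝ E] (n : ℕ)
    (k : ℂ → E) : ℂ → E :=
  convolution ((shrinkingBump n).normed volume) k (ContinuousLinearMap.lsmul ℝ ℝ) volume

lemma mollify_apply {E : Type*} [NormedAddCommGroup E] [NormedSpace ℝ E] (n : ℕ) (k : ℂ → E)
    (z : ℂ) : mollify n k z = ∫ t, (shrinkingBump n).normed volume t • k (z - t) := rfl

lemma ae_tendsto_mollify {E : Type*} [NormedAddCommGroup E] [NormedSpace ℝ E] [CompleteSpace E]
    {k : ℂ → E} (hk : LocallyIntegrable k) :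
    ∀ᵐ z, Tendsto (fun n => mollify n k z) atTop (nhds (k z)) := by
  refine ContDiffBump.ae_convolution_tendsto_right_of_locallyIntegrable (K := 2)
    tendsto_shrinkingBump_rOut (Eventually.of_forall fun n => ?_) hk
  simp only [shrinkingBump]
  linarith

lemma contDiff_mollify {E : Type*} [NormedAddCommGroup E] [NormedSpace ℝ E] [CompleteSpace E]
    {k : ℂ → E} (hk : LocallyIntegrable k) (n : ℕ) : ContDiff ℝ ∞ (mollify n k) :=
  (shrinkingBump n).hasCompactSupport_normed.contDiff_convolution_left _
    (shrinkingBump n).contDiff_normed hk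

lemma normed_shrinkingBump_eq_zero {n : ℕ} {t : ℂ} (ht : 1 / ((n : ℝ) + 1) ≤ ‖t‖) :
    (shrinkingBump n).normed volume t = 0 := by
  have : t ∉ Function.support ((shrinkingBump n).normed (volume : Measure ℂ)) := by
    rw [ContDiffBump.support_normed_eq]
    simpa [shrinkingBump] using ht
  simpa using this

variable {k : ℂ → ℝ}

lemma locallyIntegrable_of_mem_Icc (hkm : Measurable k) (hk : ∀ z, k z ∈ Icc (0 : ℝ) 1) :
    LocallyIntegrable k :=
  (memLp_top_of_bound hkm.aestronglyMeasurable 1 (Eventually.of_forall fun z => by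
    rw [Real.norm_eq_abs, abs_of_nonneg (hk z).1]; exact (hk z).2)).locallyIntegrable le_top

lemma integrable_normed_mul (hkm : Measurable k) (hk : ∀ z, k z ∈ Icc (0 : ℝ) 1) (n : ℕ) (z : ℂ) :
    Integrable fun t => (shrinkingBump n).normed volume t * k (z - t) :=
  (shrinkingBump n).integrable_normed.mul_bdd (c := 1)
    (hkm.comp (measurable_const.sub measurable_id)).aestronglyMeasurable
    (Eventually.of_forall fun t => by
      rw [Real.norm_eq_abs, abs_of_nonneg (hk _).1]; exact (hk _).2)

lemma mollify_mem_Icc (hkm : Measurable k) (hk : ∀ z, k z ∈ Icc (0 : ℝ) 1) (n : ℕ) (z : ℂ) :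
    mollify n k z ∈ Icc (0 : ℝ) 1 := by
  simp only [mollify_apply, smul_eq_mul]
  have h0 := (shrinkingBump n).nonneg_normed (μ := volume)
  refine ⟨integral_nonneg fun t => mul_nonneg (h0 t) (hk _).1, ?_⟩
  rw [← (shrinkingBump n).integral_normed (μ := volume)]
  exact integral_mono (integrable_normed_mul hkm hk n z) (shrinkingBump n).integrable_normed
    fun t => mul_le_of_le_one_right (h0 t) (hk _).2

lemma mollify_eq_zero {n : ℕ} {z : ℂ} (hz : ∀ w ∈ ball z (1 / (n + 1)), k w = 0) :
    mollify n k z = 0 := by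
  rw [mollify_apply]
  refine integral_eq_zero_of_ae (Eventually.of_forall fun t => ?_)
  by_cases ht : ‖t‖ < 1 / (n + 1)
  · simp [hz (z - t) (by simpa using ht)]
  · simp [normed_shrinkingBump_eq_zero (not_lt.1 ht)]

/-- Mollification preserves the sub-mean value inequality on circles of radius `r`. -/
lemma mollify_le_circle_mean (hkm : Measurable k) (hk : ∀ z, k z ∈ Icc (0 : ℝ) 1) {n : ℕ}
    {z : ℂ} {r : ℝ} (hmean : ∀ w ∈ ball z (1 / (n + 1)), k w ≤ (2 * Real.pi)⁻¹ *
      ∫ θ in (0 : ℝ)..(2 * Real.pi), k (w + r * Complex.exp (θ * Complex.I))) :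
    mollify n k z ≤ (2 * Real.pi)⁻¹ *
      ∫ θ in (0 : ℝ)..(2 * Real.pi), mollify n k (z + r * Complex.exp (θ * Complex.I)) := by
  have hpi : (0 : ℝ) ≤ 2 * Real.pi := by positivity
  simp only [intervalIntegral.integral_of_le hpi] at hmean ⊢
  set ν := (volume : Measure ℝ).restrict (Ioc 0 (2 * Real.pi))
  set η := (shrinkingBump n).normed (volume : Measure ℂ) with hη
  have h0 : ∀ t, 0 ≤ η t := (shrinkingBump n).nonneg_normed (μ := volume)
  have hηm : Measurable η := (shrinkingBump n).continuous_normed.measurable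
  have hηi : Integrable η := (shrinkingBump n).integrable_normed
  simp only [mollify_apply, smul_eq_mul, ← hη]
  have hint : Integrable (Function.uncurry fun (θ : ℝ) (t : ℂ) =>
      η t * k (z + r * Complex.exp (θ * Complex.I) - t)) (ν.prod volume) := by
    refine (hηi.comp_snd ν).mul_bdd (c := 1) (Measurable.aestronglyMeasurable ?_)
      (Eventually.of_forall fun p => ?_)
    · exact hkm.comp (by fun_prop)
    · rw [Real.norm_eq_abs, abs_of_nonneg (hk _).1]
      exact (hk _).2
  rw [integral_integral_swap hint, ← integral_const_mul]
  refine integral_mono (integrable_normed_mul hkm hk n z) (hint.integral_prod_right.const_mul _)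
    fun t => ?_
  simp only [integral_const_mul]
  by_cases ht : ‖t‖ < 1 / (n + 1)
  · have := hmean (z - t) (by simpa using ht)
    calc η t * k (z - t) ≤ η t * _ := mul_le_mul_of_nonneg_left this (h0 t)
      _ = _ := by
        rw [mul_left_comm]
        simp only [sub_add_eq_add_sub]
  · simp [hη, normed_shrinkingBump_eq_zero (not_lt.1 ht)]

end Mollification

section Cutoffs

open scoped ContDiff

lemma exists_smooth_cutoff_of_cutoff {S K V : Set ℂ} (hK : IsCompact K) (hV : IsOpen V)
    (hKV : K ⊆ V) {k : ℂ → ℝ} (hkm : Measurable k) (hk : ∀ z, k z ∈ Icc (0 : ℝ) 1)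
    (hkV : ∀ z ∈ V, k z = 0) {δ : ℝ} (hδ : 0 < δ)
    (hmean : ∀ c r, 0 < r → closedBall c r ⊆ thickening δ S → k c ≤ (2 * Real.pi)⁻¹ *
      ∫ θ in (0 : ℝ)..(2 * Real.pi), k (c + r * Complex.exp (θ * Complex.I)))
    {G : ℂ → ℝ} (hG : Integrable G) {η : ℝ} (hη : ∫ z, (1 - k z) * G z < η) :
    ∃ τ : ℂ → ℝ, ContDiff ℝ ∞ τ ∧ (∀ z, τ z ∈ Icc (0 : ℝ) 1) ∧ (∀ z ∈ S, 0 ≤ lapl τ z) ∧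
      (∀ z ∈ K, ∀ᶠ w in nhds z, τ w = 0) ∧ ∫ z, (1 - τ z) * G z < η := by
  have hloc := locallyIntegrable_of_mem_Icc hkm hk
  have hlim : Tendsto (fun n => ∫ z, (1 - mollify n k z) * G z) atTop
      (nhds (∫ z, (1 - k z) * G z)) := by
    refine tendsto_integral_of_dominated_convergence (fun z => ‖G z‖) (fun n => ?_) hG.norm
      (fun n => Eventually.of_forall fun z => ?_) ?_
    · exact (continuous_const.sub (contDiff_mollify hloc n).continuous).aestronglyMeasurable.mul
        hG.aestronglyMeasurable
    · have h1 := mollify_mem_Icc hkm hk n z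
      rw [norm_mul, Real.norm_eq_abs, abs_of_nonneg (by linarith [h1.2])]
      exact mul_le_of_le_one_left (norm_nonneg _) (by linarith [h1.1])
    · filter_upwards [ae_tendsto_mollify hloc] with z hz
      exact (tendsto_const_nhds.sub hz).mul tendsto_const_nhds
  obtain ⟨ε, hε, hεV⟩ := hK.exists_thickening_subset_open hV hKV
  have hsmall : ∀ a : ℝ, 0 < a → ∀ᶠ n : ℕ in atTop, 1 / ((n : ℝ) + 1) < a := fun a ha =>
    tendsto_one_div_add_atTop_nhds_zero_nat.eventually_lt_const ha
  obtain ⟨n, hn1, hn2, hn3⟩ := ((hsmall _ (half_pos hε)).and ((hsmall _ (half_pos hδ)).and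
    (hlim.eventually_lt_const hη))).exists
  refine ⟨mollify n k, contDiff_mollify hloc n, mollify_mem_Icc hkm hk n, fun z hz => ?_,
    fun z hz => ?_, hn3⟩
  · refine lapl_nonneg ((contDiff_mollify hloc n).of_le (WithTop.coe_le_coe.2 le_top))
      (half_pos hδ) fun r hr hrδ => mollify_le_circle_mean hkm hk fun w hw => hmean w r hr ?_
    have hw' : dist w z < 1 / ((n : ℝ) + 1) := hw
    exact (closedBall_subset_ball' (by linarith)).trans (ball_subset_thickening hz δ)
  · filter_upwards [ball_mem_nhds z (half_pos hε)] with w hw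
    have hw' : dist w z < ε / 2 := hw
    refine mollify_eq_zero fun x hx => hkV x (hεV (ball_subset_thickening hz ε ?_))
    exact ball_subset_ball' (by linarith) hx

/-- Smooth cutoffs which are subharmonic near a compact set, vanish near a compact part of the
`-∞`-set of a subharmonic function and are close to `1` on average. -/
lemma exists_smooth_subharmonic_cutoff {u : ℂ → EReal} {Ω S K : Set ℂ} (hu : SubharmonicOn u Ω)
    (hS : IsCompact S) (hSΩ : S ⊆ Ω) (hK : IsCompact K) (hKS : K ⊆ S) (hKu : ∀ z ∈ K, u z = ⊥)
    {G : ℂ → ℝ} (hG : Integrable G) (hGS : ∀ z ∉ S, G z = 0) {η : ℝ} (hη : 0 < η) :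
    ∃ τ : ℂ → ℝ, ContDiff ℝ ∞ τ ∧ (∀ z, τ z ∈ Icc (0 : ℝ) 1) ∧ (∀ z ∈ S, 0 ≤ lapl τ z) ∧
      (∀ z ∈ K, ∀ᶠ w in nhds z, τ w = 0) ∧ ∫ z, (1 - τ z) * G z < η := by
  have hnull := hu.volume_eq_bot
  obtain ⟨hΩ, husc, htop, -, hsub⟩ := hu
  obtain ⟨δ, hδ, hδΩ⟩ := hS.exists_cthickening_subset_open hΩ hSΩ
  obtain ⟨B₀, hB₀⟩ := exists_real_bound hS.cthickening (husc.mono hδΩ)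
    fun z hz => htop z (hδΩ hz)
  set W := thickening δ S with hW
  have hWo : IsOpen W := isOpen_thickening
  have hWΩ : W ⊆ Ω := (thickening_subset_cthickening δ S).trans hδΩ
  have hSW : S ⊆ W := self_subset_thickening hδ S
  set B := max B₀ 0
  have hB0 : 0 ≤ B := le_max_right _ _
  have hB : ∀ z ∈ W, u z ≤ (B : EReal) := fun z hz =>
    (hB₀ z (thickening_subset_cthickening δ S hz)).trans (EReal.coe_le_coe_iff.2 (le_max_left _ _))
  set M : ℕ → ℝ := fun n => n + 1
  have hM : ∀ n, 0 < M n := fun n => by positivity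
  have hBM : ∀ n, 0 < B + M n := fun n => add_pos_of_nonneg_of_pos hB0 (hM n)
  set k : ℕ → ℂ → ℝ := fun n => W.indicator fun z => (truncBelow u (M n) z + M n) / (B + M n)
    with hkdef
  have hkW : ∀ n, ∀ z ∈ W, k n z = (truncBelow u (M n) z + M n) / (B + M n) := fun n z hz =>
    indicator_of_mem hz _
  have hkm : ∀ n, Measurable (k n) := by
    intro n
    refine measurable_of_restrict_of_restrict_compl hWo.measurableSet ?_ ?_
    · have h1 : UpperSemicontinuous (W.domRestrict (truncBelow u (M n))) :=
        upperSemicontinuousOn_iff_restrict.2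
          ((upperSemicontinuousOn_truncBelow husc htop (M n)).mono hWΩ)
      have h2 : W.domRestrict (k n)
          = fun x => (W.domRestrict (truncBelow u (M n)) x + M n) / (B + M n) :=
        funext fun x => hkW n x x.2
      rw [h2]
      exact (h1.measurable.add_const _).div_const _
    · have h2 : Wᶜ.domRestrict (k n) = fun _ => 0 := by
        ext x
        have : (x : ℂ) ∉ W := x.2
        simp [hkdef, domRestrict_apply, this]
      rw [h2]
      exact measurable_const
  have hk : ∀ n z, k n z ∈ Icc (0 : ℝ) 1 := by
    intro n z
    by_cases hz : z ∈ W
    · rw [hkW n z hz]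
      have h1 := neg_le_truncBelow (M n) (htop z (hWΩ hz))
      have h2 := truncBelow_le (M := M n) (hB z hz) (by linarith [hM n])
      exact ⟨div_nonneg (by linarith) (hBM n).le, (div_le_one (hBM n)).2 (by linarith)⟩
    · simp [hkdef, indicator_of_notMem hz]
  have hT : ∀ n, ∀ z ∈ W, truncBelow u (M n) z = (B + M n) * k n z - M n := fun n z hz => by
    rw [hkW n z hz]
    have := (hBM n).ne'
    field_simp
    ring
  have hmean : ∀ n c r, 0 < r → closedBall c r ⊆ W → k n c ≤ (2 * Real.pi)⁻¹ *
      ∫ θ in (0 : ℝ)..(2 * Real.pi), k n (c + r * Complex.exp (θ * Complex.I)) := by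
    intro n c r hr hcr
    have h1 := truncBelow_le_circle_mean husc htop hsub hr (hcr.trans hWΩ) (M := M n)
      (fun z hz => hB z (hcr hz)) (by linarith [hM n])
    have hki : IntervalIntegrable (fun θ : ℝ => k n (c + r * Complex.exp (θ * Complex.I))) volume
        0 (2 * Real.pi) := by
      refine (intervalIntegrable_const (c := (1 : ℝ))).mono_fun
        ((hkm n).comp (by fun_prop)).aestronglyMeasurable (Eventually.of_forall fun θ => ?_)
      simp only [Real.norm_eq_abs, abs_of_nonneg (hk n _).1, abs_one]
      exact (hk n _).2
    simp only [hT n _ (hcr (circle_mem_closedBall c hr.le _)),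
      hT n _ (hcr (mem_closedBall_self hr.le))] at h1
    rw [intervalIntegral.integral_sub (hki.const_mul _) intervalIntegrable_const,
      intervalIntegral.integral_const_mul, intervalIntegral.integral_const] at h1
    refine le_of_mul_le_mul_left ?_ (hBM n)
    have hpi := Real.pi_ne_zero
    have h2 : (2 * Real.pi)⁻¹ * ((2 * Real.pi - 0) • M n) = M n := by
      rw [smul_eq_mul, sub_zero]
      field_simp
    rw [mul_sub, h2] at h1
    linarith
  have hlim : Tendsto (fun n => ∫ z, (1 - k n z) * G z) atTop (nhds 0) := by
    rw [← integral_zero ℂ ℝ (μ := volume)]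
    refine tendsto_integral_of_dominated_convergence (fun z => ‖G z‖) (fun n => ?_) hG.norm
      (fun n => Eventually.of_forall fun z => ?_) ?_
    · exact (measurable_const.sub (hkm n)).aestronglyMeasurable.mul hG.aestronglyMeasurable
    · have h1 := hk n z
      rw [norm_mul, Real.norm_eq_abs, abs_of_nonneg (by linarith [h1.2])]
      exact mul_le_of_le_one_left (norm_nonneg _) (by linarith [h1.1])
    · filter_upwards [compl_mem_ae_iff.2 hnull] with z hz
      by_cases hzS : z ∈ S
      · have hzW := hSW hzS
        have hne : u z ≠ ⊥ := fun h => hz ⟨hSΩ hzS, h⟩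
        have hx := EReal.coe_toReal (htop z (hSΩ hzS)) hne
        set x := (u z).toReal
        have hlow : ∀ n, 1 - (B - x) / (B + M n) ≤ k n z := by
          intro n
          have h1 : x ≤ truncBelow u (M n) z := by
            rw [← EReal.coe_le_coe_iff, coe_truncBelow (M n) (htop z (hSΩ hzS)), hx]
            exact le_max_left _ _
          rw [hkW n z hzW, le_div_iff₀ (hBM n), sub_mul, div_mul_cancel₀ _ (hBM n).ne']
          linarith
        have hdiv : Tendsto (fun n => (B - x) / (B + M n)) atTop (nhds 0) :=
          tendsto_const_nhds.div_atTop (tendsto_atTop_add_const_left _ _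
            (tendsto_atTop_add_const_right _ _ tendsto_natCast_atTop_atTop))
        have h1 : Tendsto (fun n => k n z) atTop (nhds 1) := by
          refine tendsto_of_tendsto_of_tendsto_of_le_of_le ?_ tendsto_const_nhds hlow
            fun n => (hk n z).2
          simpa using tendsto_const_nhds.sub hdiv
        simpa using ((tendsto_const_nhds (x := (1 : ℝ))).sub h1).mul_const (G z)
      · simp [hGS z hzS]
  obtain ⟨n, hn⟩ := (hlim.eventually_lt_const hη).exists
  refine exists_smooth_cutoff_of_cutoff hK isOpen_interior (V := interior {w | k n w = 0})
    (fun z hz => ?_) (hkm n) (hk n) (fun z hz => (interior_subset hz : z ∈ {w | k n w = 0})) hδ (hmean n) hG hn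
  have hzW := hSW (hKS hz)
  rw [mem_interior_iff_mem_nhds]
  have h1 := husc z (hWΩ hzW) ((-M n : ℝ) : EReal) (by simp [hKu z hz, -EReal.coe_neg, EReal.bot_lt_coe])
  rw [hΩ.nhdsWithin_eq (hWΩ hzW)] at h1
  filter_upwards [h1, hWo.mem_nhds hzW] with w hw hwW
  have h2 : truncBelow u (M n) w = -M n := by
    rw [truncBelow, max_eq_right hw.le, EReal.toReal_coe]
  rw [hkW n w hwW, h2, neg_add_cancel, zero_div]

end Cutoffs

section WeakEquation

open scoped ContDiff

/-- Square-integrable holomorphic functions off the `-∞`-set of a subharmonic function satisfy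
the weak Cauchy–Riemann equation across that set, tested locally. -/
lemma integral_dbar_mul_indicator_of_tsupport_subset {u : ℂ → EReal} {Ω D : Set ℂ}
    (hu : SubharmonicOn u Ω) (hD : IsOpen D) (hDu : ∀ z ∉ D, u z = ⊥) {f : ℂ → ℂ}
    (hf : DifferentiableOn ℂ f D) (hf2 : MemLp (D.indicator f) 2) {ξ : ℂ → ℝ}
    (hξ : ContDiff ℝ ∞ ξ) (hξc : HasCompactSupport ξ) (hξΩ : tsupport ξ ⊆ Ω) :
    ∫ z, dbar ξ z * D.indicator f z = 0 := by
  set f₀ := D.indicator f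
  have hint : ∀ g : ℂ → ℂ, Continuous g → HasCompactSupport g → Integrable fun z => g z * f₀ z :=
    fun g hg hgc => (hg.memLp_of_hasCompactSupport (p := 2) hgc).integrable_mul hf2
  have hA : Integrable fun z => ‖f₀ z‖ ^ 2 := hf2.integrable_norm_pow (by norm_num)
  set A := ∫ z, ‖f₀ z‖ ^ 2
  have hA0 : 0 ≤ A := integral_nonneg fun z => by positivity
  set p : ℂ → ℝ := fun z => ξ z * ξ z
  have hp : ContDiff ℝ ∞ p := hξ.mul hξ
  have hpS : tsupport p ⊆ tsupport ξ := tsupport_mul_subset_left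
  have hpc : HasCompactSupport p := hξc.mul_left
  have hlpc : HasCompactSupport (lapl p) :=
    hpc.mono' fun z hz => by_contra fun h => hz (lapl_of_notMem_tsupport h)
  have hG₁ : Integrable fun z => ‖dbar ξ z * f₀ z‖ := (hint _ (continuous_dbar hξ) hξc.dbar).norm
  have hG₂ : Integrable fun z => |lapl p z| :=
    ((continuous_lapl hp).integrable_of_hasCompactSupport hlpc).norm
  have hbound : ∀ s : ℝ, 0 < s →
      ‖∫ z, dbar ξ z * f₀ z‖ ≤ s ^ 2 + (s / 2 * A + (2 * s)⁻¹ * s ^ 2) := by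
    intro s hs
    obtain ⟨τ, hτ, hτI, hτl, hτK, hτη⟩ := exists_smooth_subharmonic_cutoff hu hξc.isCompact hξΩ
      (hξc.isCompact.inter_right hD.isClosed_compl) inter_subset_left (fun z hz => hDu z hz.2)
      (hG₁.add hG₂) (fun z hz => by
        simp [dbar_of_notMem_tsupport hz, lapl_of_notMem_tsupport fun h => hz (hpS h)])
      (by positivity : 0 < s ^ 2)
    have hmul : ∀ {g : ℂ → ℝ}, Integrable g → Integrable fun z => (1 - τ z) * g z := by
      intro g hg
      refine hg.bdd_mul (c := 1) (continuous_const.sub hτ.continuous).aestronglyMeasurable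
        (Eventually.of_forall fun z => ?_)
      have := hτI z
      rw [Real.norm_eq_abs, abs_of_nonneg (by linarith [this.2])]
      linarith [this.1]
    have hη₁ : ∫ z, (1 - τ z) * ‖dbar ξ z * f₀ z‖ ≤ s ^ 2 := by
      refine (integral_mono (hmul hG₁) (hmul (hG₁.add hG₂)) fun z => ?_).trans hτη.le
      exact mul_le_mul_of_nonneg_left (le_add_of_nonneg_right (abs_nonneg _))
        (by linarith [(hτI z).2])
    have hη₂ : ∫ z, (1 - τ z) * |lapl p z| ≤ s ^ 2 := by
      refine (integral_mono (hmul hG₂) (hmul (hG₁.add hG₂)) fun z => ?_).trans hτη.le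
      exact mul_le_mul_of_nonneg_left (le_add_of_nonneg_left (norm_nonneg _))
        (by linarith [(hτI z).2])
    have henergy : ∫ z, p z * ‖dbar τ z‖ ^ 2 ≤ s ^ 2 :=
      (integral_mul_norm_dbar_sq_le hp hpc (fun z => mul_self_nonneg _) hτ (fun z => (hτI z).1)
        (fun z => (hτI z).2) fun z hz => hτl z (hpS hz)).trans hη₂
    have hψ : ContDiff ℝ ∞ fun z => ξ z * τ z := hξ.mul hτ
    have hψc : HasCompactSupport fun z => ξ z * τ z := hξc.mul_right
    have hψD : tsupport (fun z => ξ z * τ z) ⊆ D := by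
      intro z hz
      by_contra hzD
      refine notMem_tsupport_iff_eventuallyEq.2 ?_ hz
      filter_upwards [hτK z ⟨tsupport_mul_subset_left hz, hzD⟩] with w hw
      simp [hw]
    have hzero : ∫ z, dbar (fun w => ξ w * τ w) z * f₀ z = 0 := by
      rw [← integral_dbar_mul_eq_zero hD hf hψ hψc hψD]
      congr 1 with z
      by_cases hz : z ∈ D
      · simp [f₀, hz]
      · simp [dbar_of_notMem_tsupport fun h => hz (hψD h)]
    have hI₁ : Integrable fun z => (((1 - τ z : ℝ) : ℂ) * dbar ξ z) * f₀ z := by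
      refine hint _ ?_ hξc.dbar.mul_left
      have h1 := hτ.continuous
      have h2 := continuous_dbar hξ
      fun_prop
    have hI₂ : Integrable fun z => ((ξ z : ℂ) * dbar τ z) * f₀ z := by
      refine hint _ ?_ (HasCompactSupport.mul_right (hξc.comp_left Complex.ofReal_zero))
      have h1 := hξ.continuous
      have h2 := continuous_dbar hτ
      fun_prop
    have hI₃ : Integrable fun z => dbar (fun w => ξ w * τ w) z * f₀ z :=
      hint _ (continuous_dbar hψ) hψc.dbar
    have hsplit : ∫ z, dbar ξ z * f₀ z = (∫ z, (((1 - τ z : ℝ) : ℂ) * dbar ξ z) * f₀ z)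
        - ∫ z, ((ξ z : ℂ) * dbar τ z) * f₀ z := by
      have hI₁₂ : Integrable fun z =>
          (((1 - τ z : ℝ) : ℂ) * dbar ξ z) * f₀ z - ((ξ z : ℂ) * dbar τ z) * f₀ z := hI₁.sub hI₂
      rw [← integral_sub hI₁ hI₂, ← add_zero (∫ z, _ - _), ← hzero, ← integral_add hI₁₂ hI₃]
      congr 1 with z
      rw [dbar_mul hξ hτ]
      push_cast
      ring
    rw [hsplit]
    refine (norm_sub_le _ _).trans (add_le_add ?_ ?_)
    · refine (norm_integral_le_integral_norm _).trans (le_of_eq_of_le ?_ hη₁)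
      congr 1 with z
      rw [mul_assoc, norm_mul, Complex.norm_real, Real.norm_eq_abs,
        abs_of_nonneg (by linarith [(hτI z).2])]
    · have hJ : Integrable fun z => p z * ‖dbar τ z‖ ^ 2 :=
        (hp.continuous.mul ((continuous_dbar hτ).norm.pow 2)).integrable_of_hasCompactSupport
          hpc.mul_right
      calc ‖∫ z, ((ξ z : ℂ) * dbar τ z) * f₀ z‖ ≤ ∫ z, ‖((ξ z : ℂ) * dbar τ z) * f₀ z‖ :=
            norm_integral_le_integral_norm _
        _ ≤ ∫ z, (s / 2 * ‖f₀ z‖ ^ 2 + (2 * s)⁻¹ * (p z * ‖dbar τ z‖ ^ 2)) := by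
            refine integral_mono hI₂.norm ((hA.const_mul _).add (hJ.const_mul _)) fun z => ?_
            have h1 : p z * ‖dbar τ z‖ ^ 2 = (|ξ z| * ‖dbar τ z‖) ^ 2 := by
              rw [mul_pow, sq_abs, sq (ξ z)]
            simp only [norm_mul, Complex.norm_real, Real.norm_eq_abs, h1]
            set x := |ξ z| * ‖dbar τ z‖
            have h2 := mul_nonneg (by positivity : 0 ≤ (2 * s)⁻¹) (sq_nonneg (s * ‖f₀ z‖ - x))
            have h3 : (2 * s)⁻¹ * (s * ‖f₀ z‖ - x) ^ 2
                = s / 2 * ‖f₀ z‖ ^ 2 + (2 * s)⁻¹ * x ^ 2 - x * ‖f₀ z‖ := by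
              field_simp
              ring
            linarith
        _ = s / 2 * A + (2 * s)⁻¹ * ∫ z, p z * ‖dbar τ z‖ ^ 2 := by
            rw [integral_add (hA.const_mul _) (hJ.const_mul _), integral_const_mul,
              integral_const_mul]
        _ ≤ _ := by gcongr
  by_contra hne
  have hL : 0 < ‖∫ z, dbar ξ z * f₀ z‖ := norm_pos_iff.2 hne
  set L := ‖∫ z, dbar ξ z * f₀ z‖
  have hs : 0 < min 1 (L / (A + 3)) := by positivity
  have h1 := hbound _ hs
  set s := min 1 (L / (A + 3))
  have hs1 : s ≤ 1 := min_le_left _ _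
  have hs2 : s * (A + 3) ≤ L := by
    rw [← le_div_iff₀ (by positivity)]
    exact min_le_right _ _
  have h2 : (2 * s)⁻¹ * s ^ 2 = s / 2 := by field_simp
  rw [h2] at h1
  nlinarith

/-- Square-integrable holomorphic functions off the `-∞`-set of a subharmonic function satisfy
the weak Cauchy–Riemann equation across that set. -/
lemma integral_dbar_mul_indicator_eq_zero {u : ℂ → EReal} {Ω D : Set ℂ}
    (hu : SubharmonicOn u Ω) (hD : IsOpen D) (hDΩ : Dᶜ ⊆ Ω) (hDu : ∀ z ∉ D, u z = ⊥) {f : ℂ → ℂ}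
    (hf : DifferentiableOn ℂ f D) (hf2 : MemLp (D.indicator f) 2) {φ : ℂ → ℝ}
    (hφ : ContDiff ℝ ∞ φ) (hφc : HasCompactSupport φ) :
    ∫ z, dbar φ z * D.indicator f z = 0 := by
  have hK : IsCompact (tsupport φ ∩ Dᶜ) := hφc.isCompact.inter_right hD.isClosed_compl
  have hΩ := hu.1
  obtain ⟨δ, hδ, hδΩ⟩ := hK.exists_cthickening_subset_open hΩ (inter_subset_right.trans hDΩ)
  obtain ⟨θ, hθ1, hθ0, -⟩ := exists_contMDiffMap_one_nhds_of_subset_interior (n := ⊤)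
    (modelWithCornersSelf ℝ ℂ) hK.isClosed (t := cthickening δ (tsupport φ ∩ Dᶜ))
    ((self_subset_thickening hδ _).trans (thickening_subset_interior_cthickening δ _))
  have hθ : ContDiff ℝ ∞ θ := θ.contMDiff.contDiff
  have ha : ContDiff ℝ ∞ fun z => φ z * θ z := hφ.mul hθ
  have hb : ContDiff ℝ ∞ fun z => φ z * (1 - θ z) := hφ.mul (contDiff_const.sub hθ)
  have hac : HasCompactSupport fun z => φ z * θ z := hφc.mul_right
  have hbc : HasCompactSupport fun z => φ z * (1 - θ z) := hφc.mul_right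
  have haΩ : tsupport (fun z => φ z * θ z) ⊆ Ω := by
    refine (closure_minimal (fun z hz => ?_) isClosed_cthickening).trans hδΩ
    by_contra h
    exact hz (by simp [hθ0 z h])
  have hbD : tsupport (fun z => φ z * (1 - θ z)) ⊆ D := by
    intro z hz
    by_contra hzD
    refine notMem_tsupport_iff_eventuallyEq.2 ?_ hz
    filter_upwards [eventually_nhdsSet_iff_forall.1 hθ1 z
      ⟨tsupport_mul_subset_left hz, hzD⟩] with w hw
    simp [hw]
  have hsum : ∀ z, dbar φ z
      = dbar (fun z => φ z * θ z) z + dbar (fun z => φ z * (1 - θ z)) z := by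
    intro z
    have h1 : φ = fun z => φ z * θ z + φ z * (1 - θ z) := by
      ext z
      ring
    have h2 := fderiv_fun_add (ha.differentiable (by simp) z) (hb.differentiable (by simp) z)
    rw [← h1] at h2
    simp only [dbar, h2, add_apply]
    push_cast
    ring
  have hint : ∀ {g : ℂ → ℝ}, ContDiff ℝ ∞ g → HasCompactSupport g →
      Integrable fun z => dbar g z * D.indicator f z := fun hg hgc =>
    ((continuous_dbar hg).memLp_of_hasCompactSupport (p := 2) hgc.dbar).integrable_mul hf2
  have hb0 : ∫ z, dbar (fun z => φ z * (1 - θ z)) z * D.indicator f z = 0 := by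
    rw [← integral_dbar_mul_eq_zero hD hf hb hbc hbD]
    congr 1 with z
    by_cases hz : z ∈ D
    · simp [hz]
    · simp [dbar_of_notMem_tsupport fun h => hz (hbD h)]
  simp only [hsum, add_mul]
  rw [integral_add (hint ha hac) (hint hb hbc), hb0,
    integral_dbar_mul_indicator_of_tsupport_subset hu hD hDu hf hf2 ha hac haΩ, add_zero]

end WeakEquation

section Liouville

open scoped ContDiff

lemma fderiv_mollify_apply {f : ℂ → ℂ} (hf : LocallyIntegrable f) (n : ℕ) (z v : ℂ) :
    fderiv ℝ (mollify n f) z v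
      = ∫ t, fderiv ℝ ((shrinkingBump n).normed volume) t v • f (z - t) := by
  have hη : ContDiff ℝ ∞ ((shrinkingBump n).normed (volume : Measure ℂ)) :=
    (shrinkingBump n).contDiff_normed
  have hηc := (shrinkingBump n).hasCompactSupport_normed (μ := (volume : Measure ℂ))
  have h1 := hηc.hasFDerivAt_convolution_left (ContinuousLinearMap.lsmul ℝ ℝ)
    (hη.of_le (WithTop.coe_le_coe.2 le_top)) hf z
  have h2 := (hηc.fderiv ℝ).convolutionExists_left
    ((ContinuousLinearMap.lsmul ℝ ℝ : ℝ →L[ℝ] ℂ →L[ℝ] ℂ).precompL ℂ)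
    (hη.continuous_fderiv (by simp)) hf z
  rw [mollify, h1.fderiv, convolution_def, ContinuousLinearMap.integral_apply h2]
  rfl

/-- A square-integrable function satisfying the weak Cauchy–Riemann equation on the whole plane
vanishes almost everywhere. -/
lemma ae_eq_zero_of_integral_dbar_mul_eq_zero {f : ℂ → ℂ} (hf : MemLp f 2)
    (hweak : ∀ φ : ℂ → ℝ, ContDiff ℝ ∞ φ → HasCompactSupport φ → ∫ z, dbar φ z * f z = 0) :
    f =ᵐ[volume] 0 := by
  have hloc : LocallyIntegrable f := hf.locallyIntegrable (by norm_num)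
  have hsq : Integrable fun z => ‖f z‖ ^ 2 := hf.integrable_norm_pow (by norm_num)
  have hconst : ∀ n z, mollify n f z = mollify n f 0 := by
    intro n z
    set η := (shrinkingBump n).normed (volume : Measure ℂ) with hηdef
    have hη : ContDiff ℝ ∞ η := (shrinkingBump n).contDiff_normed
    have hηc : HasCompactSupport η := (shrinkingBump n).hasCompactSupport_normed
    refine Differentiable.apply_eq_apply_of_bounded (fun z => ?_) ?_ z 0
    · refine differentiableAt_complex_iff_differentiableAt_real.2
        ⟨(contDiff_mollify hloc n).differentiable (by simp) z, ?_⟩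
      have hφ : ContDiff ℝ ∞ fun w => η (z - w) := hη.comp (contDiff_const.sub contDiff_id)
      have hφc : HasCompactSupport fun w => η (z - w) :=
        hηc.comp_homeomorph (Homeomorph.subLeft z)
      have hd : ∀ w, dbar (fun w => η (z - w)) w = - dbar η (z - w) := by
        intro w
        have h1 : HasFDerivAt (fun w => η (z - w)) (-(fderiv ℝ η (z - w))) w := by
          refine ((hη.differentiable (by simp) (z - w)).hasFDerivAt.comp w
            ((hasFDerivAt_id w).const_sub z)).congr_fderiv ?_
          ext v
          simp
        simp only [dbar, h1.fderiv, neg_apply]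
        push_cast
        ring
      have h0 := hweak _ hφ hφc
      simp only [hd] at h0
      have h1 : ∫ t, dbar η t * f (z - t) = 0 := by
        rw [← neg_eq_zero, ← h0, ← integral_neg,
          ← integral_sub_left_eq_self _ _ z]
        simp
      have hint : ∀ v, Integrable fun t => fderiv ℝ η t v • f (z - t) := fun v =>
        (hηc.fderiv_apply_const v).convolutionExists_left (ContinuousLinearMap.lsmul ℝ ℝ)
          (hη.fderiv_apply_const v).continuous hloc z
      have h2 : ∫ t, dbar η t * f (z - t) = (∫ t, fderiv ℝ η t 1 • f (z - t))
          + Complex.I * ∫ t, fderiv ℝ η t Complex.I • f (z - t) := by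
        rw [← integral_const_mul, ← integral_add (hint 1) ((hint Complex.I).const_mul _)]
        congr 1 with t
        simp only [dbar, Complex.real_smul]
        ring
      rw [fderiv_mollify_apply hloc, fderiv_mollify_apply hloc, smul_eq_mul, ← hηdef]
      rw [h2] at h1
      linear_combination (-Complex.I) * h1
        + (∫ t, fderiv ℝ η t Complex.I • f (z - t)) * Complex.I_mul_I
    · have hsupp : HasCompactSupport fun t => η t ^ 2 :=
        hηc.mono fun t ht h0 => ht (by beta_reduce; rw [h0, zero_pow two_ne_zero])
      have hη2 : Integrable fun t => η t ^ 2 :=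
        (hη.continuous.pow 2).integrable_of_hasCompactSupport hsupp
      refine isBounded_iff_forall_norm_le.2 ⟨(∫ t, η t ^ 2) + ∫ t, ‖f t‖ ^ 2, ?_⟩
      rintro _ ⟨z, rfl⟩
      have hsq' : Integrable fun t => ‖f (z - t)‖ ^ 2 := hsq.comp_sub_left z
      rw [← integral_sub_left_eq_self (fun t => ‖f t‖ ^ 2) volume z, ← integral_add hη2 hsq',
        mollify_apply]
      refine norm_integral_le_of_norm_le (hη2.add hsq') (Eventually.of_forall fun t => ?_)
      rw [norm_smul, Real.norm_eq_abs, ← sq_abs (η t)]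
      nlinarith [sq_nonneg (|η t| - ‖f (z - t)‖), sq_nonneg (|η t| + ‖f (z - t)‖)]
  have hae := ae_tendsto_mollify hloc
  obtain ⟨w, hw⟩ := hae.exists
  have hfw : f =ᵐ[volume] fun _ => f w := by
    filter_upwards [hae] with z hz
    simp only [hconst _ z, hconst _ w] at hz hw
    exact tendsto_nhds_unique hz hw
  have hc := (memLp_const_iff (by norm_num) (by norm_num)).1 (hf.ae_eq hfw)
  simp only [measure_univ_of_isAddLeftInvariant, lt_self_iff_false, or_false] at hc
  filter_upwards [hfw] with z hz
  rw [hz, hc, Pi.zero_apply]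

/-- If `ℂ \ D` is polar, then `L²ₕ(D) = {0}`. -/
lemma eqOn_zero_of_polarSet_compl {D : Set ℂ} (hD : IsOpen D) (hpolar : PolarSet Dᶜ)
    {f : ℂ → ℂ} (hf : f ∈ L2h D) : EqOn f 0 D := by
  obtain ⟨Ω, hDΩ, u, hu, hDu⟩ := hpolar
  have hf2 : MemLp (D.indicator f) 2 := (memLp_indicator_iff_restrict hD.measurableSet).2
    ((memLp_two_iff_integrable_sq_norm
      (hf.1.continuousOn.aestronglyMeasurable hD.measurableSet)).2 hf.2)
  have h0 := ae_eq_zero_of_integral_dbar_mul_eq_zero hf2 fun φ hφ hφc =>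
    integral_dbar_mul_indicator_eq_zero hu hD hDΩ hDu hf.1 hf2 hφ hφc
  refine Measure.eqOn_open_of_ae_eq (μ := volume) ((ae_restrict_iff' hD.measurableSet).2 ?_) hD
    hf.1.continuousOn continuousOn_const
  filter_upwards [h0] with z hz hzD
  rwa [indicator_of_mem hzD] at hz

/-- If `ℂ \ D` is polar, then `L²ₕ(D × V) = {0}` for every open `V ⊆ ℂ`. -/
lemma eqOn_zero_prod_of_polarSet_compl {D V : Set ℂ} (hD : IsOpen D) (hV : IsOpen V)
    (hpolar : PolarSet Dᶜ) {f : ℂ × ℂ → ℂ} (hf : f ∈ L2h (D ×ˢ V)) : EqOn f 0 (D ×ˢ V) := by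
  have hint : Integrable (fun p => ‖f p‖ ^ 2) ((volume.restrict D).prod (volume.restrict V)) := by
    rw [Measure.prod_restrict]
    exact hf.2
  have hae := (ae_restrict_iff' hV.measurableSet).1 hint.prod_left_ae
  rintro ⟨z, w⟩ ⟨hz, hw⟩
  have hslice : ContinuousOn (fun w => f (z, w)) V :=
    hf.1.continuousOn.comp (by fun_prop) fun w hw => ⟨hz, hw⟩
  refine Measure.eqOn_open_of_ae_eq (μ := volume) (f := fun w => f (z, w)) (g := 0)
    ((ae_restrict_iff' hV.measurableSet).2 ?_) hV hslice continuousOn_const hw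
  filter_upwards [hae] with w hw hwV
  exact eqOn_zero_of_polarSet_compl hD hpolar (f := fun z => f (z, w))
    ⟨hf.1.comp (by fun_prop) fun z hz => ⟨hz, hwV⟩, hw hwV⟩ hz

lemma hartogs_eq_prod {D : Set ℂ} {ρ : ℂ → EReal} {c : ℝ} (hρ : ∀ z ∈ D, ρ z = (c : EReal)) :
    hartogs D ρ = D ×ˢ ball 0 (Real.exp (-c)) := by
  ext ⟨z, w⟩
  simp only [hartogs, mem_ofPred_eq, mem_prod, mem_ball_zero_iff]
  refine and_congr_right fun hz => ?_
  rw [hρ z hz, elog, ← EReal.coe_neg]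
  split_ifs with h
  · exact iff_of_true (EReal.bot_lt_coe _) (h.trans_lt (Real.exp_pos _))
  · rw [EReal.coe_lt_coe_iff, Real.log_lt_iff_lt_exp (not_le.1 h)]

end Liouville

/-- **Corollary 7, degenerate case.** If `ℂ \ D` is polar and `ρ ≡ c ∈ ℝ`,
then `L²ₕ(G_{D,ρ}) = {0}`; in particular every `f ∈ L²ₕ(G_{D,ρ})` extends to an entire
function on `ℂ²`, i.e. the `L²ₕ`-hull of `G_{D,ρ}` is `ℂ²`. -/
theorem trivial_L2h_of_polar_complement (D : Set ℂ) (hDopen : IsOpen D)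
    (hDconn : IsConnected D) (hpolar : PolarSet Dᶜ)
    (ρ : ℂ → EReal) (c : ℝ) (hρc : ∀ z ∈ D, ρ z = (c : EReal)) :
    (∀ f ∈ L2h (hartogs D ρ), ∀ p ∈ hartogs D ρ, f p = 0) ∧
      ∀ f ∈ L2h (hartogs D ρ), ∃ F : ℂ × ℂ → ℂ, Differentiable ℂ F ∧
        Set.EqOn F f (hartogs D ρ) := by
  have h0 : ∀ f ∈ L2h (hartogs D ρ), ∀ p ∈ hartogs D ρ, f p = 0 := by
    rw [hartogs_eq_prod hρc]
    exact fun f hf p hp => eqOn_zero_prod_of_polarSet_compl hDopen isOpen_ball hpolar hf hp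
  exact ⟨h0, fun f hf => ⟨0, differentiable_const 0, fun p hp => (h0 f hf p hp).symm⟩⟩
end

section
/- Let D ⊂ ℂ be a domain and ρ : D → [-∞,∞) a subharmonic function. If the Hartogs domain G_{D,ρ} ⊂ ℂ² is an L²_h-domain of holomorphy and G_{D,ρ} ≠ ℂ², then L²_h(G_{D,ρ}) is infinite-dimensional. -/
open MeasureTheory Filter Metric Set

lemma injective_exp_I_pow : Function.Injective fun j : ℕ => Complex.exp Complex.I ^ j := by
  intro j k h
  simp only [← Complex.exp_nat_mul] at h
  obtain ⟨n, hn⟩ := Complex.exp_eq_exp_iff_exists_int.1 h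
  have h1 : (j : ℝ) = k + n * (2 * Real.pi) := by
    have := congrArg Complex.im hn
    simpa using this
  by_contra hjk
  have hn0 : n ≠ 0 := by
    rintro rfl
    exact hjk (by exact_mod_cast (by simpa using h1 : (j : ℝ) = k))
  refine (irrational_pi.intCast_mul (mul_ne_zero hn0 two_ne_zero)).ne_int ((j : ℤ) - k) ?_
  push_cast
  linarith

/-- A nonzero polynomial vanishes at only finitely many powers of an `ω` of infinite order. -/
lemma exists_forall_ge_sum_mul_pow_ne_zero {ω : ℂ} (hω : Function.Injective fun j : ℕ => ω ^ j)
    {N : ℕ} {c : Fin N → ℂ} (hc : c ≠ 0) :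
    ∃ M : ℕ, ∀ j ≥ M, ∑ i, c i * (ω ^ j) ^ (i : ℕ) ≠ 0 := by
  set P : Polynomial ℂ := ∑ i, Polynomial.C (c i) * Polynomial.X ^ (i : ℕ) with hP
  have hP0 : P ≠ 0 := by
    intro h
    apply hc
    ext i
    have := congrArg (fun p => Polynomial.coeff p (i : ℕ)) h
    simpa [hP, Polynomial.finsetSum_coeff, Polynomial.coeff_C_mul, Polynomial.coeff_X_pow,
      ← Fin.ext_iff] using this
  have hfin : {j : ℕ | P.IsRoot (ω ^ j)}.Finite :=
    (Polynomial.finite_setOfPred_isRoot hP0).preimage hω.injOn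
  obtain ⟨M, hM⟩ := hfin.bddAbove
  refine ⟨M + 1, fun j hj h0 => ?_⟩
  have : j ≤ M := hM (by simpa [hP, Polynomial.IsRoot, Polynomial.eval_finsetSum] using h0)
  omega

lemma sum_mul_pow_mul_iteratedDeriv_eq_zero {F : ℂ → ℂ} {r : ℝ} (hr : 0 < r)
    (hF : DifferentiableOn ℂ F (ball 0 r)) {ω : ℂ} (hω : ‖ω‖ = 1) {N : ℕ} (c : Fin N → ℂ)
    (h : ∀ w ∈ ball (0 : ℂ) r, ∑ i, c i * F (ω ^ (i : ℕ) * w) = 0) (j : ℕ) :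
    (∑ i, c i * (ω ^ j) ^ (i : ℕ)) * iteratedDeriv j F 0 = 0 := by
  have h0 : (0 : ℂ) ∈ ball (0 : ℂ) r := mem_ball_self hr
  have hmaps (i : ℕ) : MapsTo (ω ^ i * ·) (ball (0 : ℂ) r) (ball 0 r) := fun w hw => by
    simpa [hω] using hw
  have hdiff (i : ℕ) : DifferentiableOn ℂ (fun w => F (ω ^ i * w)) (ball 0 r) :=
    hF.comp (by fun_prop) (hmaps i)
  have key : iteratedDerivWithin j (fun w => ∑ i : Fin N, c i * F (ω ^ (i : ℕ) * w))
      (ball 0 r) 0 = 0 := by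
    rw [iteratedDerivWithin_congr (g := fun _ => 0) h h0]
    simp
  rw [iteratedDerivWithin_fun_sum h0 isOpen_ball.uniqueDiffOn fun (i : Fin N) _ =>
    (((hdiff i).const_mul (c i)).contDiffOn isOpen_ball) 0 h0] at key
  rw [← iteratedDerivWithin_of_isOpen isOpen_ball h0, Finset.sum_mul]
  refine (Finset.sum_congr rfl fun i _ => ?_).trans key
  rw [iteratedDerivWithin_const_mul_field,
    iteratedDerivWithin_comp_const_smul h0 isOpen_ball.uniqueDiffOn
      (hF.contDiffOn isOpen_ball) _ (hmaps i)]
  simp only [mul_zero, smul_eq_mul]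
  ring

lemma exists_ball_subset_hartogs {D : Set ℂ} (hD : IsOpen D) {ρ : ℂ → EReal}
    (hρ : UpperSemicontinuousOn ρ D) {z : ℂ} (hz : z ∈ D) (hz' : ρ z ≠ ⊤) :
    ∃ r > 0, ball ((z, 0) : ℂ × ℂ) r ⊆ hartogs D ρ := by
  obtain ⟨t, ht, -⟩ := EReal.lt_iff_exists_real_btwn.1 (lt_top_iff_ne_top.2 hz')
  have hev := hρ z hz t ht
  rw [hD.nhdsWithin_eq hz] at hev
  obtain ⟨s, hs, hsub⟩ := Metric.eventually_nhds_iff_ball.1 (hev.and (hD.mem_nhds hz))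
  refine ⟨min s (Real.exp (-t)), lt_min hs (Real.exp_pos _), fun p hp => ?_⟩
  rw [← ball_prod_same, Set.mem_prod] at hp
  obtain ⟨h1, h2⟩ := hsub p.1 (ball_subset_ball (min_le_left _ _) hp.1)
  refine ⟨h2, lt_of_le_of_lt ?_ (EReal.neg_lt_neg_iff.2 h1)⟩
  have h3 : ‖p.2‖ < Real.exp (-t) := by
    simpa using ball_subset_ball (min_le_right _ _) hp.2
  unfold elog
  split_ifs with h4
  · exact bot_le
  · rw [not_le] at h4
    rw [← EReal.coe_neg, EReal.coe_le_coe_iff]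
    exact ((Real.log_lt_iff_lt_exp h4).2 h3).le

lemma comp_rotation_mem_L2h {D : Set ℂ} {ρ : ℂ → EReal} {f : ℂ × ℂ → ℂ}
    (hf : f ∈ L2h (hartogs D ρ)) {a : ℂ} (ha : ‖a‖ = 1) :
    (fun p : ℂ × ℂ => f (p.1, a * p.2)) ∈ L2h (hartogs D ρ) := by
  have hpre : (fun p : ℂ × ℂ => (p.1, a * p.2)) ⁻¹' hartogs D ρ = hartogs D ρ := by
    ext p
    simp [hartogs, ha]
  refine ⟨hf.1.comp (by fun_prop) hpre.symm.subset, ?_⟩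
  set e : ℂ ≃ₗᵢ[ℝ] ℂ := rotation ⟨a, by simpa [Submonoid.unitSphere] using ha⟩
  have hmp : MeasurePreserving (fun p : ℂ × ℂ => (p.1, a * p.2)) volume volume :=
    (MeasurePreserving.id volume).prod e.measurePreserving
  have hemb : MeasurableEmbedding (fun p : ℂ × ℂ => (p.1, a * p.2)) :=
    ((Homeomorph.refl ℂ).prodCongr e.toHomeomorph).measurableEmbedding
  have := (hmp.integrableOn_comp_preimage hemb).2 hf.2
  rwa [hpre] at this

/-- A function whose Taylor coefficients in the second variable along `D × {0}` vanish from
some order on extends holomorphically to `D × ℂ`. -/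
lemma exists_extension_of_iteratedDeriv_eq_zero {D : Set ℂ} (hD : IsOpen D) {G : Set (ℂ × ℂ)}
    {f : ℂ × ℂ → ℂ} (hf : DifferentiableOn ℂ f G)
    (hG : ∀ z ∈ D, ∃ r > 0, ball ((z, 0) : ℂ × ℂ) r ⊆ G)
    {M : ℕ} (hM : ∀ z ∈ D, ∀ j ≥ M, iteratedDeriv j (fun w => f (z, w)) 0 = 0) :
    ∃ g : ℂ × ℂ → ℂ, DifferentiableOn ℂ g (D ×ˢ univ) ∧
      ∀ z r, ball ((z, 0) : ℂ × ℂ) r ⊆ G → ball z r ⊆ D → EqOn g f (ball (z, 0) r) := by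
  set P : ℂ → Polynomial ℂ := fun z => ∑ j ∈ Finset.range M,
    Polynomial.monomial j ((j.factorial : ℂ)⁻¹ * iteratedDeriv j (fun w => f (z, w)) 0) with hP
  have hdeg (z : ℂ) : (P z).degree < M := by
    refine (Polynomial.degree_lt_iff_coeff_zero _ _).2 fun m hm => ?_
    rw [hP, Polynomial.finsetSum_coeff]
    refine Finset.sum_eq_zero fun j hj => ?_
    rw [Polynomial.coeff_monomial, if_neg]
    have := Finset.mem_range.1 hj
    omega
  have heval : ∀ z₀ r, ball ((z₀, 0) : ℂ × ℂ) r ⊆ G → ∀ z ∈ D, z ∈ ball z₀ r →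
      ∀ w ∈ ball (0 : ℂ) r, (P z).eval w = f (z, w) := by
    intro z₀ r hr z hzD hz w hw
    have hF : DifferentiableOn ℂ (fun w => f (z, w)) (ball 0 r) := by
      refine hf.comp (by fun_prop) fun v hv => hr ?_
      rw [← ball_prod_same]
      exact ⟨hz, hv⟩
    have htaylor := Complex.hasSum_taylorSeries_on_ball hF hw
    have hfin := hasSum_sum_of_ne_finset_zero (L := .unconditional ℕ) (s := Finset.range M)
      (f := fun n : ℕ => (n.factorial : ℂ)⁻¹ • (w - 0) ^ n •
        iteratedDeriv n (fun w => f (z, w)) 0) fun j hj => by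
          rw [hM z hzD j (by simpa using hj)]
          simp
    refine Eq.trans ?_ (hfin.unique htaylor)
    simp only [hP, Polynomial.eval_finsetSum, Polynomial.eval_monomial, smul_eq_mul, sub_zero]
    exact Finset.sum_congr rfl fun j _ => by ring
  refine ⟨fun p => (P p.1).eval p.2, ?_, ?_⟩
  · rintro ⟨z₀, w₀⟩ ⟨hz₀, -⟩
    obtain ⟨r₁, hr₁, hball₁⟩ := hG z₀ hz₀
    obtain ⟨r₂, hr₂, hball₂⟩ := Metric.isOpen_iff.1 hD z₀ hz₀
    set r := min r₁ r₂
    have hr : 0 < r := lt_min hr₁ hr₂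
    have hrG : ball ((z₀, 0) : ℂ × ℂ) r ⊆ G := (ball_subset_ball (min_le_left _ _)).trans hball₁
    have hrD : ball z₀ r ⊆ D := (ball_subset_ball (min_le_right _ _)).trans hball₂
    set v : ℕ → ℂ := fun i => ((r / (i + 2) : ℝ) : ℂ)
    have hv (i : ℕ) : v i ∈ ball (0 : ℂ) r := by
      rw [mem_ball_zero_iff, Complex.norm_real, Real.norm_of_nonneg (by positivity)]
      exact div_lt_self hr (by linarith [(Nat.cast_nonneg i : (0 : ℝ) ≤ i)])
    have hvinj : Function.Injective v := by
      intro i j hij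
      have h1 : r / (i + 2) = r / (j + 2) := Complex.ofReal_injective hij
      have h2 : (0 : ℝ) < i + 2 := by positivity
      have h3 : (0 : ℝ) < j + 2 := by positivity
      rw [div_eq_div_iff h2.ne' h3.ne'] at h1
      have h4 := mul_left_cancel₀ hr.ne' h1
      exact_mod_cast (by linarith : (i : ℝ) = j)
    have hlag : ∀ p ∈ ball z₀ r ×ˢ (univ : Set ℂ), (P p.1).eval p.2 =
        ∑ i ∈ Finset.range M, f (p.1, v i) *
          (Lagrange.basis (Finset.range M) v i).eval p.2 := by
      rintro ⟨z, w⟩ ⟨hz, -⟩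
      have := Lagrange.eq_interpolate_of_eval_eq (s := Finset.range M) (v := v)
        (fun i => f (z, v i)) hvinj.injOn (f := P z) (by simpa using hdeg z)
        fun i _ => heval z₀ r hrG z (hrD hz) hz _ (hv i)
      simp only [this, Lagrange.interpolate_apply, Polynomial.eval_finsetSum,
        Polynomial.eval_mul, Polynomial.eval_C]
    have hdiff : DifferentiableOn ℂ (fun p : ℂ × ℂ => ∑ i ∈ Finset.range M, f (p.1, v i) *
        (Lagrange.basis (Finset.range M) v i).eval p.2) (ball z₀ r ×ˢ (univ : Set ℂ)) := by
      refine DifferentiableOn.fun_sum fun i _ => DifferentiableOn.mul ?_ ?_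
      · refine hf.comp (by fun_prop) fun p hp => hrG ?_
        rw [← ball_prod_same]
        exact ⟨hp.1, hv i⟩
      · exact ((Lagrange.basis (Finset.range M) v i).differentiable.comp
          differentiable_snd).differentiableOn
    refine ((hdiff.congr hlag).differentiableAt ?_).differentiableWithinAt
    exact (isOpen_ball.prod isOpen_univ).mem_nhds ⟨mem_ball_self hr, mem_univ _⟩
  · rintro z₀ r hrG hrD ⟨z, w⟩ hp
    rw [← ball_prod_same] at hp
    exact heval z₀ r hrG z (hrD hp.1) hp.1 w hp.2

/-- If a Hartogs domain `G_{D,ρ} ⊊ ℂ²` is an `L²ₕ`-domain of holomorphy,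
then `L²ₕ(G_{D,ρ})` is infinite dimensional. -/
theorem hartogs_infinite_dim (D : Set ℂ) (hDopen : IsOpen D) (hDconn : IsConnected D)
    (ρ : ℂ → EReal) (hρ : SubharmonicOn ρ D)
    (hdoh : IsL2hDomainOfHolomorphy (hartogs D ρ)) (hne : hartogs D ρ ≠ Set.univ) :
    L2hInfiniteDim (hartogs D ρ) := by
  by_contra hfin
  simp only [L2hInfiniteDim, not_forall, not_exists, not_and] at hfin
  obtain ⟨N, hN⟩ := hfin
  obtain ⟨-, husc, htop, hbot, -⟩ := hρ
  have hball := fun z hz => exists_ball_subset_hartogs hDopen husc (z := z) hz (htop z hz)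
  obtain ⟨z₀, hz₀⟩ := hDconn.nonempty
  obtain ⟨r₁, hr₁, hball₁⟩ := hball z₀ hz₀
  obtain ⟨r₂, hr₂, hball₂⟩ := Metric.isOpen_iff.1 hDopen z₀ hz₀
  set r := min r₁ r₂
  have hr : 0 < r := lt_min hr₁ hr₂
  have hrG : ball ((z₀, 0) : ℂ × ℂ) r ⊆ hartogs D ρ :=
    (ball_subset_ball (min_le_left _ _)).trans hball₁
  have hrD : ball z₀ r ⊆ D := (ball_subset_ball (min_le_right _ _)).trans hball₂
  refine hdoh ⟨ball (z₀, 0) r, D ×ˢ univ, isOpen_ball,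
    ⟨nonempty_ball.2 hr, (convex_ball _ _).isPreconnected⟩, hDopen.prod isOpen_univ,
    hDconn.prod isConnected_univ, fun p hp => ⟨⟨(hrG hp).1, mem_univ _⟩, hrG hp⟩, ?_, ?_⟩
  · intro hsub
    obtain ⟨z, hz, hzbot⟩ := hbot z₀ hz₀
    have hzD := connectedComponentIn_subset _ _ hz
    have hmem := (hsub (show ((z, (Real.exp (-(ρ z).toReal) : ℂ)) : ℂ × ℂ) ∈ D ×ˢ univ from
      ⟨hzD, mem_univ _⟩)).2
    have hnorm : ‖(Real.exp (-(ρ z).toReal) : ℂ)‖ = Real.exp (-(ρ z).toReal) := by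
      rw [Complex.norm_real, Real.norm_of_nonneg (Real.exp_pos _).le]
    simp only [hnorm, elog, if_neg (Real.exp_pos _).not_ge, Real.log_exp, EReal.coe_neg,
      EReal.coe_toReal (htop z hzD) hzbot, lt_irrefl] at hmem
  · intro f hf
    set ω := Complex.exp Complex.I
    have hω : ‖ω‖ = 1 := by simp [ω, Complex.norm_exp]
    have hrot (i : Fin N) : (fun p : ℂ × ℂ => f (p.1, ω ^ (i : ℕ) * p.2)) ∈ L2h (hartogs D ρ) :=
      comp_rotation_mem_L2h hf (by simp [hω])
    obtain ⟨c, hc, hc0⟩ := hN _ hrot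
    obtain ⟨M, hM⟩ := exists_forall_ge_sum_mul_pow_ne_zero injective_exp_I_pow hc0
    obtain ⟨g, hg, hgf⟩ := exists_extension_of_iteratedDeriv_eq_zero hDopen hf.1 hball (M := M)
      fun z hz j hj => by
        obtain ⟨s, hs, hsG⟩ := hball z hz
        have hmaps : MapsTo (fun w : ℂ => (z, w)) (ball 0 s) (hartogs D ρ) := fun w hw => hsG (by
          rw [← ball_prod_same]
          exact ⟨mem_ball_self hs, hw⟩)
        refine (mul_eq_zero.1 (sum_mul_pow_mul_iteratedDeriv_eq_zero hs
          (hf.1.comp (by fun_prop) hmaps) hω c (fun w hw => hc _ (hmaps hw)) j)).resolve_left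
          (hM j hj)
    exact ⟨g, hg, hgf z₀ r hrG hrD⟩
end

section
/- Let D ⊂ ℂ be a domain, ρ : D → [-∞,∞) subharmonic, and let f be a holomorphic function on G_{D,ρ} with Hartogs expansion f(z₁,z₂) = Σ_{j≥0} f_j(z₁) z₂ʲ. Let U ⊂ D be an open disc and M₁ ∈ ℝ such that limsup_{j→∞} (1/j) log|f_j(z₁)| < M₁ for every z₁ ∈ U. Then the series Σ_{j≥0} f_j(z₁) z₂ʲ converges locally uniformly on U × e^{-M₁}𝔻 (where 𝔻 is the open unit disc) and defines a holomorphic function F on U × e^{-M₁}𝔻 with F = f on G_{D,ρ} ∩ (U × e^{-M₁}𝔻). -/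
open MeasureTheory Filter Metric Set

/-- `log ‖f‖` satisfies the sub-mean value inequality for `f` analytic. -/
theorem log_norm_le_circleAverage {f : ℂ → ℂ} {c : ℂ} {R : ℝ} (hR : 0 < R)
    (hf : AnalyticOnNhd ℂ f (closedBall c R)) (hc : f c ≠ 0) :
    Real.log ‖f c‖ ≤ Real.circleAverage (fun z => Real.log ‖f z‖) c R := by
  have hf' : AnalyticOnNhd ℂ f (closedBall c |R|) := by rwa [abs_of_pos hR]
  rw [hf'.circleAverage_log_norm hR.ne' hc]
  refine le_add_of_nonneg_left (finsum_nonneg fun u => ?_)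
  by_cases hu : u ∈ closedBall c |R|
  · refine mul_nonneg (mod_cast MeromorphicOn.AnalyticOnNhd.divisor_nonneg hf' u) ?_
    rcases eq_or_ne c u with rfl | h
    · simp
    · have h1 : 0 < ‖c - u‖ := norm_pos_iff.2 (sub_ne_zero.2 h)
      rw [mem_closedBall, dist_comm, dist_eq_norm, abs_of_pos hR] at hu
      exact Real.log_nonneg (by rw [← div_eq_mul_inv, one_le_div h1]; exact hu)
  · rw [Function.locallyFinsuppWithin.apply_eq_zero_of_notMem _ hu]
    simp

/-- `‖f‖ ^ α` satisfies the sub-mean value inequality for `f` analytic and `α > 0`. -/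
theorem norm_rpow_le_circleAverage {f : ℂ → ℂ} {c : ℂ} {R α : ℝ} (hR : 0 < R) (hα : 0 < α)
    (hf : AnalyticOnNhd ℂ f (closedBall c R)) :
    ‖f c‖ ^ α ≤ Real.circleAverage (fun z => ‖f z‖ ^ α) c R := by
  by_cases hc : f c = 0
  · rw [hc, norm_zero, Real.zero_rpow hα.ne']
    exact Real.circleAverage_nonneg_of_nonneg fun z _ => by positivity
  have hs : sphere c |R| ⊆ closedBall c R := by
    rw [abs_of_pos hR]; exact sphere_subset_closedBall
  set s : ℝ := Real.log ‖f c‖ * α with hs_def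
  have hexp : ‖f c‖ ^ α = Real.exp s := Real.rpow_def_of_pos (norm_pos_iff.2 hc) α
  have hlog : CircleIntegrable (fun z => Real.log ‖f z‖) c R :=
    (hf.mono hs).meromorphicOn.circleIntegrable_log_norm
  have hcont : ContinuousOn (fun z => ‖f z‖ ^ α) (sphere c |R|) :=
    ((hf.continuousOn.mono hs).norm).rpow_const fun _ _ => Or.inr hα.le
  have hzero : f ⁻¹' {0}ᶜ ∈ codiscreteWithin (sphere c |R|) :=
    codiscreteWithin_mono hs (hf.preimage_zero_mem_codiscreteWithin hc
      (mem_closedBall_self hR.le)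
      ((convex_closedBall c R).isConnected ⟨c, mem_closedBall_self hR.le⟩))
  have hlin : CircleIntegrable
      (fun z => Real.exp s * (1 - s) + (Real.exp s * α) • Real.log ‖f z‖) c R :=
    (circleIntegrable_const _ _ _).add hlog.const_fun_smul
  classical
  let t : ℂ → ℝ := fun z =>
    if f z = 0 then Real.exp s * (1 - s) + (Real.exp s * α) • Real.log ‖f z‖ else ‖f z‖ ^ α
  have ht : (fun z => ‖f z‖ ^ α) =ᶠ[codiscreteWithin (sphere c |R|)] t := by
    filter_upwards [hzero] with z hz
    exact (if_neg hz).symm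
  have htint : CircleIntegrable t c R :=
    CircleIntegrable.congr_codiscreteWithin ht hcont.circleIntegrable'
  rw [Real.circleAverage_congr_codiscreteWithin ht hR.ne']
  refine le_trans ?_ (Real.circleAverage_mono hlin htint fun z _ => ?_)
  · rw [Real.circleAverage_fun_add (circleIntegrable_const _ _ _) hlog.const_fun_smul,
      Real.circleAverage_const, Real.circleAverage_fun_smul, hexp, smul_eq_mul]
    have h := mul_le_mul_of_nonneg_left (log_norm_le_circleAverage hR hf hc)
      (by positivity : 0 ≤ Real.exp s * α)
    have h2 : Real.exp s * α * Real.log ‖f c‖ = Real.exp s * s := by rw [hs_def]; ring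
    linarith
  · by_cases hz : f z = 0
    · simp [t, hz]
    · simp only [t, if_neg hz, smul_eq_mul]
      rw [Real.rpow_def_of_pos (norm_pos_iff.2 hz)]
      have h := mul_le_mul_of_nonneg_left (Real.add_one_le_exp (Real.log ‖f z‖ * α - s))
        (Real.exp_pos s).le
      rw [← Real.exp_add, add_sub_cancel] at h
      linarith

/-- The sub-mean value inequality over circles implies the one over the disc. -/
theorem mul_area_le_integral_ball {h : ℂ → ℝ} {w : ℂ} {R : ℝ} (hR : 0 < R)
    (hc : ContinuousOn h (closedBall w R))
    (hsub : ∀ r ∈ Ioo 0 R, h w ≤ Real.circleAverage h w r) :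
    h w * (Real.pi * R ^ 2) ≤ ∫ z in ball w R, h z := by
  have hpi := Real.pi_pos
  let φ : ℝ × ℝ → ℝ := fun p => p.1 * h (circleMap w p.1 p.2)
  have hmap : MapsTo (fun p : ℝ × ℝ => circleMap w p.1 p.2) (Icc 0 R ×ˢ Icc (-Real.pi) Real.pi)
      (closedBall w R) := by
    rintro ⟨r, θ⟩ ⟨hr, -⟩
    simp only [mem_closedBall, dist_eq_norm, circleMap_sub_center, norm_circleMap_zero]
    rw [abs_of_nonneg hr.1]; exact hr.2
  have hφc : ContinuousOn φ (Icc 0 R ×ˢ Icc (-Real.pi) Real.pi) := by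
    refine continuousOn_fst.mul (hc.comp (Continuous.continuousOn ?_) hmap)
    unfold circleMap; fun_prop
  have hφi : IntegrableOn φ (Ioo 0 R ×ˢ Ioo (-Real.pi) Real.pi) :=
    (hφc.integrableOn_compact (isCompact_Icc.prod isCompact_Icc)).mono_set
      (prod_mono Ioo_subset_Icc_self Ioo_subset_Icc_self)
  have hpolar : ∫ z in ball w R, h z = ∫ p in Ioo 0 R ×ˢ Ioo (-Real.pi) Real.pi, φ p := by
    rw [← integral_indicator measurableSet_ball, ← integral_add_left_eq_self _ w,
      ← Complex.integral_comp_polarCoord_symm,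
      ← integral_indicator (polarCoord.open_target.measurableSet),
      ← integral_indicator (measurableSet_Ioo.prod measurableSet_Ioo)]
    congr 1
    ext ⟨r, θ⟩
    have hcm : w + Complex.polarCoord.symm (r, θ) = circleMap w r θ := by
      simp [circleMap, Complex.exp_mul_I]
    by_cases hr : 0 < r ∧ θ ∈ Ioo (-Real.pi) Real.pi
    · have h1 : (r, θ) ∈ polarCoord.target := hr
      rw [indicator_of_mem h1, hcm]
      by_cases hrR : r < R
      · have h2 : circleMap w r θ ∈ ball w R := by
          simp [dist_eq_norm, abs_of_pos hr.1, hrR]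
        have h3 : (r, θ) ∈ Ioo 0 R ×ˢ Ioo (-Real.pi) Real.pi := ⟨⟨hr.1, hrR⟩, hr.2⟩
        rw [indicator_of_mem h2, indicator_of_mem h3, smul_eq_mul]
      · have h2 : circleMap w r θ ∉ ball w R := by
          simpa [dist_eq_norm, abs_of_pos hr.1] using hrR
        have h3 : (r, θ) ∉ Ioo 0 R ×ˢ Ioo (-Real.pi) Real.pi := fun h => hrR h.1.2
        rw [indicator_of_notMem h2, indicator_of_notMem h3, smul_zero]
    · have h1 : (r, θ) ∉ polarCoord.target := hr
      have h3 : (r, θ) ∉ Ioo 0 R ×ˢ Ioo (-Real.pi) Real.pi := fun h => hr ⟨h.1.1, h.2⟩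
      rw [indicator_of_notMem h1, indicator_of_notMem h3]
  rw [hpolar, Measure.volume_eq_prod, setIntegral_prod _ hφi]
  have hinner : ∀ r : ℝ, ∫ θ in Ioo (-Real.pi) Real.pi, φ (r, θ)
      = r * (2 * Real.pi * Real.circleAverage h w r) := by
    intro r
    rw [Real.circleAverage_eq_integral_add (-Real.pi),
      intervalIntegral.integral_comp_add_right (fun θ => h (circleMap w r θ)), integral_const_mul,
      ← integral_Ioc_eq_integral_Ioo, ← intervalIntegral.integral_of_le (by linarith), smul_eq_mul,
      mul_inv_cancel_left₀ (by positivity)]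
    ring_nf
  have hint : IntegrableOn (fun r => ∫ θ in Ioo (-Real.pi) Real.pi, φ (r, θ)) (Ioo 0 R) := by
    have := hφi
    rw [IntegrableOn, Measure.volume_eq_prod, ← Measure.prod_restrict] at this
    exact this.integral_prod_left
  have hconst : ∫ r in Ioo 0 R, r * (2 * Real.pi * h w) = h w * (Real.pi * R ^ 2) := by
    rw [integral_mul_const, ← integral_Ioc_eq_integral_Ioo, ← intervalIntegral.integral_of_le hR.le,
      integral_id]
    ring
  rw [← hconst]
  refine setIntegral_mono_on ?_ hint measurableSet_Ioo fun r hr => ?_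
  · exact (Continuous.continuousOn (by fun_prop)).integrableOn_compact isCompact_Icc |>.mono_set
      Ioo_subset_Icc_self
  · rw [hinner]
    have := hr.1
    gcongr
    exact hsub r hr

/-- The Hartogs lemma on sequences of subharmonic functions, for the functions `‖g j‖ ^ (1 / j)`. -/
theorem hartogs_lemma {g : ℕ → ℂ → ℂ} {a : ℂ} {R₀ B m m' : ℝ} (hR₀ : 0 < R₀) (hm : 0 < m)
    (hmm' : m < m') (hB0 : 0 ≤ B) (hg : ∀ j, DifferentiableOn ℂ (g j) (ball a R₀))
    (hB : ∀ j, 1 ≤ j → ∀ z ∈ ball a R₀, ‖g j z‖ ≤ B ^ j)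
    (hlim : ∀ z ∈ ball a R₀, ∀ᶠ j in atTop, ‖g j z‖ ≤ m ^ j) :
    ∃ η > 0, ∀ᶠ j in atTop, ∀ w ∈ ball a η, ‖g j w‖ ≤ m' ^ j := by
  have hpi := Real.pi_pos
  obtain ⟨R, hR, hR2⟩ : ∃ R : ℝ, 0 < R ∧ 2 * R = R₀ := ⟨R₀ / 2, by positivity, by ring⟩
  obtain ⟨η, ⟨hη, hηR⟩, hη0⟩ : ∃ η : ℝ, (m * (R + η) ^ 2 < m' * R ^ 2 ∧ η < R) ∧ 0 < η := by
    have h1 : ∀ᶠ η : ℝ in nhds 0, m * (R + η) ^ 2 < m' * R ^ 2 := by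
      refine ContinuousAt.eventually_lt (by fun_prop) (by fun_prop) ?_
      simp only [add_zero]
      gcongr
    exact (((h1.and (eventually_lt_nhds hR)).filter_mono nhdsWithin_le_nhds).and
      (self_mem_nhdsWithin (s := Ioi (0 : ℝ)))).exists
  let S := ball a (R + η)
  have hS : S ⊆ ball a R₀ := ball_subset_ball (by linarith)
  let v : ℕ → ℂ → ℝ := fun j z => max (‖g j z‖ ^ ((j : ℝ)⁻¹)) m
  have hgc : ∀ j : ℕ, ContinuousOn (fun z => ‖g j z‖ ^ ((j : ℝ)⁻¹)) (ball a R₀) := fun j =>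
    (hg j).continuousOn.norm.rpow_const fun _ _ => Or.inr (by positivity)
  have hmeas : ∀ j, AEStronglyMeasurable (v j) (volume.restrict S) := fun j =>
    (((hgc j).mono hS).sup continuousOn_const).aestronglyMeasurable measurableSet_ball
  have hroot : ∀ {x y : ℝ} {j : ℕ}, 1 ≤ j → 0 ≤ x → 0 ≤ y → x ≤ y ^ j → x ^ ((j : ℝ)⁻¹) ≤ y := by
    intro x y j hj hx hy hxy
    calc x ^ ((j : ℝ)⁻¹) ≤ (y ^ j) ^ ((j : ℝ)⁻¹) := by gcongr
      _ = y := Real.pow_rpow_inv_natCast hy (by lia)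
  have hvB : ∀ j, 1 ≤ j → ∀ z ∈ S, ‖v j z‖ ≤ max B m := by
    intro j hj z hz
    rw [Real.norm_of_nonneg (hm.le.trans (le_max_right _ _))]
    exact max_le_max_right m (hroot hj (norm_nonneg _) hB0 (hB j hj z (hS hz)))
  have hfin : IsFiniteMeasure (volume.restrict S) := ⟨by
    rw [Measure.restrict_apply_univ]; exact measure_ball_lt_top⟩
  have hvint : ∀ j, 1 ≤ j → Integrable (v j) (volume.restrict S) := fun j hj =>
    (integrable_const (max B m)).mono' (hmeas j)
      ((ae_restrict_iff' measurableSet_ball).2 (.of_forall (hvB j hj)))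
  have htend : Tendsto (fun j => ∫ z in S, v j z) atTop (nhds (∫ _ in S, m)) := by
    refine tendsto_integral_filter_of_dominated_convergence (fun _ => max B m)
      (.of_forall hmeas) ?_ (integrable_const _) ?_
    · filter_upwards [eventually_ge_atTop 1] with j hj
      exact (ae_restrict_iff' measurableSet_ball).2 (.of_forall (hvB j hj))
    · refine (ae_restrict_iff' measurableSet_ball).2 (.of_forall fun z hz => ?_)
      refine tendsto_const_nhds.congr' ?_
      filter_upwards [hlim z (hS hz), eventually_ge_atTop 1] with j hj hj1
      exact (max_eq_right (hroot hj1 (norm_nonneg _) hm.le hj)).symm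
  have hval : ∫ _ in S, m = m * (Real.pi * (R + η) ^ 2) := by
    rw [setIntegral_const, Measure.real, Complex.volume_ball, smul_eq_mul, mul_comm]
    simp [ENNReal.toReal_mul, ENNReal.toReal_pow, ENNReal.toReal_ofReal (by linarith : 0 ≤ R + η)]
    left; ring
  have hlt : ∫ _ in S, m < m' * (Real.pi * R ^ 2) := by
    rw [hval]; nlinarith
  refine ⟨η, hη0, ?_⟩
  filter_upwards [htend.eventually_lt_const hlt, eventually_ge_atTop 1] with j hj hj1 w hw
  have hj0 : (0 : ℝ) < (j : ℝ)⁻¹ := by positivity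
  have hcb : closedBall w R ⊆ ball a R₀ := fun z hz => by
    rw [mem_ball] at hw ⊢
    rw [mem_closedBall] at hz
    linarith [dist_triangle z w a]
  have hball : ball w R ⊆ S := fun z hz => by
    rw [mem_ball] at hw hz ⊢
    linarith [dist_triangle z w a]
  have han : AnalyticOnNhd ℂ (g j) (closedBall w R) :=
    ((hg j).analyticOnNhd isOpen_ball).mono hcb
  have h1 : ‖g j w‖ ^ ((j : ℝ)⁻¹) * (Real.pi * R ^ 2) ≤ ∫ z in S, v j z := by
    refine (mul_area_le_integral_ball hR ((hgc j).mono hcb) fun r hr =>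
      norm_rpow_le_circleAverage hr.1 hj0 (han.mono (closedBall_subset_closedBall hr.2.le))).trans ?_
    calc ∫ z in ball w R, ‖g j z‖ ^ ((j : ℝ)⁻¹)
        ≤ ∫ z in ball w R, v j z := by
          refine setIntegral_mono_on ?_ ((hvint j hj1).mono_measure
            (Measure.restrict_mono hball le_rfl)) measurableSet_ball fun z _ => le_max_left _ _
          exact (((hgc j).mono hcb).integrableOn_compact (isCompact_closedBall w R)).mono_set
            ball_subset_closedBall
      _ ≤ ∫ z in S, v j z := by
          refine setIntegral_mono_set (hvint j hj1) (.of_forall fun z => ?_)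
            (LE.le.eventuallyLE hball)
          exact hm.le.trans (le_max_right _ _)
  have h2 : ‖g j w‖ ^ ((j : ℝ)⁻¹) ≤ m' :=
    (lt_of_mul_lt_mul_right (h1.trans_lt hj) (by positivity)).le
  calc ‖g j w‖ = (‖g j w‖ ^ ((j : ℝ)⁻¹)) ^ j :=
        (Real.rpow_inv_natCast_pow (norm_nonneg _) (by lia)).symm
    _ ≤ m' ^ j := by gcongr

/-- A series of holomorphic functions on a complex normed space, dominated by a summable series,
has a holomorphic sum. -/
theorem differentiableOn_tsum_of_summable_bound {E : Type*} [NormedAddCommGroup E]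
    [NormedSpace ℂ E] {F : ℕ → E → ℂ} {u : ℕ → ℝ} (hu : Summable u) {U : Set E} (hU : IsOpen U)
    (hF : ∀ i, DifferentiableOn ℂ (F i) U) (hbound : ∀ i, ∀ w ∈ U, ‖F i w‖ ≤ u i) :
    DifferentiableOn ℂ (fun w => ∑' i, F i w) U := by
  intro p hp
  obtain ⟨ε, hε, hεU⟩ := Metric.isOpen_iff.1 hU p hp
  obtain ⟨δ, hδ, rfl⟩ : ∃ δ > 0, ε = δ + δ := ⟨ε / 2, by positivity, by ring⟩
  let _ : NormedSpace ℝ E := NormedSpace.restrictScalars ℝ ℂ E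
  have hsub : ∀ x ∈ ball p δ, ball x δ ⊆ U := fun x hx z hz => hεU <| by
    rw [mem_ball] at hx hz ⊢
    linarith [dist_triangle z x p]
  have hV : ball p δ ⊆ U := hsub p (mem_ball_self hδ)
  refine (hasFDerivAt_tsum_of_isPreconnected (𝕜 := ℂ) (x₀ := p) (s := ball p δ)
    (u := fun i => 2 * u i / δ) ((hu.mul_left 2).div_const δ) isOpen_ball
    (convex_ball p δ).isPreconnected
    (fun i x hx => ((hF i).differentiableAt (hU.mem_nhds (hV hx))).hasFDerivAt)
    (fun i x hx => ?_) (mem_ball_self hδ)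
    (Summable.of_norm_bounded hu fun i => hbound i p hp)
    (mem_ball_self hδ)).differentiableAt.differentiableWithinAt
  refine Complex.norm_fderiv_le_div_of_mapsTo_ball ((hF i).mono (hsub x hx)) (fun z hz => ?_) hδ
  have h1 := hbound i z (hsub x hx hz)
  have h2 := hbound i x (hV hx)
  rw [mem_closedBall, dist_eq_norm]
  linarith [norm_sub_le (F i z) (F i x)]

theorem eventually_norm_le_pow_of_coeffGrowth_lt {fj : ℕ → ℂ → ℂ} {z : ℂ} {M : ℝ}
    (h : coeffGrowth fj z < (M : EReal)) : ∀ᶠ j in atTop, ‖fj j z‖ ≤ Real.exp M ^ j := by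
  filter_upwards [eventually_lt_of_limsup_lt h, eventually_ge_atTop 1] with j hj hj1
  rcases (norm_nonneg (fj j z)).eq_or_lt with h0 | h0
  · rw [← h0]; positivity
  have hj0 : (0 : ℝ) < j := by exact_mod_cast hj1
  rw [elog, if_neg h0.not_ge, ← EReal.coe_mul, EReal.coe_lt_coe_iff, inv_mul_lt_iff₀ hj0] at hj
  rw [← Real.exp_nat_mul]
  exact (Real.log_le_iff_le_exp h0).1 hj.le

theorem mem_hartogs_of_norm_lt {D : Set ℂ} {ρ : ℂ → EReal} {z w : ℂ} {m : ℝ} (hz : z ∈ D)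
    (hρ : ρ z < m) (hw : ‖w‖ < Real.exp (-m)) : (z, w) ∈ hartogs D ρ := by
  refine ⟨hz, lt_trans ?_ (EReal.neg_lt_neg_iff.2 hρ)⟩
  rw [← EReal.coe_neg]
  unfold elog
  split_ifs with h
  · exact EReal.bot_lt_coe _
  · exact EReal.coe_lt_coe_iff.2 ((Real.log_lt_iff_lt_exp (not_le.1 h)).2 hw)

theorem coeff_eq_of_hasSum_pow {F : ℂ → ℂ} {b : ℕ → ℂ} {s : ℝ} (hs : 0 < s)
    (hF : DifferentiableOn ℂ F (ball 0 s))
    (hsum : ∀ w ∈ ball (0 : ℂ) s, HasSum (fun j => b j * w ^ j) (F w)) (j : ℕ) :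
    b j = iteratedDeriv j F 0 / j.factorial := by
  have h1 : HasFPowerSeriesAt F (FormalMultilinearSeries.ofScalars ℂ b) 0 := by
    rw [hasFPowerSeriesAt_iff]
    filter_upwards [ball_mem_nhds (0 : ℂ) hs] with w hw
    simpa [mul_comm] using hsum w hw
  have h2 := (hF.analyticAt (ball_mem_nhds 0 hs)).hasFPowerSeriesAt
  simpa using congrArg (fun p => p.coeff j) (h1.eq_formalMultilinearSeries h2)

/-- Cauchy's estimates for the coefficients of a convergent power series. -/
theorem norm_coeff_le_of_hasSum_pow {F : ℂ → ℂ} {b : ℕ → ℂ} {s t C : ℝ} (hs : 0 < s)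
    (hst : s < t) (hF : DifferentiableOn ℂ F (ball 0 t))
    (hsum : ∀ w ∈ ball (0 : ℂ) t, HasSum (fun j => b j * w ^ j) (F w))
    (hC : ∀ w ∈ sphere (0 : ℂ) s, ‖F w‖ ≤ C) (j : ℕ) : ‖b j‖ ≤ C / s ^ j := by
  have hcauchy := Complex.norm_iteratedDeriv_le_of_forall_mem_sphere_norm_le j hs
    ((hF.mono (closedBall_subset_ball hst)).diffContOnCl_ball le_rfl) hC
  rw [coeff_eq_of_hasSum_pow (hs.trans hst) hF hsum j, norm_div, Complex.norm_natCast,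
    div_le_iff₀ (by positivity)]
  exact hcauchy.trans_eq (by ring)

/-- The functions `‖f_j‖ ^ (1 / j)` of a Hartogs expansion are locally uniformly bounded. -/
theorem HartogsExpansion.exists_local_bound {D : Set ℂ} (hD : IsOpen D) {ρ : ℂ → EReal}
    (hρ : SubharmonicOn ρ D) {f : ℂ × ℂ → ℂ} (hf : DifferentiableOn ℂ f (hartogs D ρ))
    {fj : ℕ → ℂ → ℂ} (hexp : HartogsExpansion D ρ f fj) {a : ℂ} (ha : a ∈ D) :
    ∃ δ > 0, ∃ B : ℝ, 0 ≤ B ∧ ∀ j, 1 ≤ j → ∀ z ∈ ball a δ, ‖fj j z‖ ≤ B ^ j := by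
  obtain ⟨-, husc, htop, -⟩ := hρ
  obtain ⟨m, hm, -⟩ := EReal.lt_iff_exists_real_btwn.1 (lt_top_iff_ne_top.2 (htop a ha))
  have hev : ∀ᶠ z in nhds a, z ∈ D ∧ ρ z < m := by
    have := husc a ha m hm
    rw [hD.nhdsWithin_eq ha] at this
    exact (hD.eventually_mem ha).and this
  obtain ⟨ε, hε, hεD⟩ := Metric.eventually_nhds_iff_ball.1 hev
  obtain ⟨s, hs, hsm⟩ : ∃ s : ℝ, 0 < s ∧ s < Real.exp (-m) := exists_between (Real.exp_pos _)
  have hK : closedBall a (ε / 2) ×ˢ closedBall (0 : ℂ) s ⊆ hartogs D ρ := by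
    rintro ⟨z, w⟩ ⟨hz, hw⟩
    have hz' := hεD z (closedBall_subset_ball (by linarith) hz)
    exact mem_hartogs_of_norm_lt hz'.1 hz'.2 ((mem_closedBall_zero_iff.1 hw).trans_lt hsm)
  obtain ⟨C, hC⟩ := ((isCompact_closedBall a (ε / 2)).prod
    (isCompact_closedBall (0 : ℂ) s)).exists_bound_of_continuousOn (hf.continuousOn.mono hK)
  refine ⟨ε / 2, by positivity, max C 1 / s, by positivity, fun j hj z hz => ?_⟩
  have hzD := hεD z (ball_subset_ball (by linarith) hz)
  have hmem : ∀ w ∈ ball (0 : ℂ) (Real.exp (-m)), (z, w) ∈ hartogs D ρ := fun w hw =>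
    mem_hartogs_of_norm_lt hzD.1 hzD.2 (mem_ball_zero_iff.1 hw)
  have hF : DifferentiableOn ℂ (fun w => f (z, w)) (ball 0 (Real.exp (-m))) :=
    hf.comp ((differentiableOn_const z).prodMk differentiableOn_id) hmem
  have hcoeff : ‖fj j z‖ ≤ C / s ^ j :=
    norm_coeff_le_of_hasSum_pow (b := fun j => fj j z) hs hsm hF
      (fun w hw => hexp.2 (z, w) (hmem w hw))
      (fun w hw => hC (z, w) (mk_mem_prod (ball_subset_closedBall hz)
        (sphere_subset_closedBall hw))) j
  have hpow : C ≤ max C 1 ^ j :=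
    (le_max_left C 1).trans (le_self_pow₀ (le_max_right _ _) (Nat.one_le_iff_ne_zero.1 hj))
  rw [div_pow]
  exact hcoeff.trans (div_le_div_of_nonneg_right hpow (pow_nonneg hs.le j))

theorem exists_geometric_bound {g : ℕ → ℂ → ℂ} {K : Set ℂ} (hK : IsCompact K)
    (hg : ∀ j, ContinuousOn (g j) K) {m : ℝ} (hm : 0 < m)
    (h : ∀ᶠ j in atTop, ∀ z ∈ K, ‖g j z‖ ≤ m ^ j) :
    ∃ C : ℝ, ∀ j, ∀ z ∈ K, ‖g j z‖ ≤ C * m ^ j := by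
  obtain ⟨N, hN⟩ := eventually_atTop.1 h
  choose c hc using fun j => hK.exists_bound_of_continuousOn (hg j)
  refine ⟨1 + ∑ j ∈ Finset.range N, |c j| / m ^ j, fun j z hz => ?_⟩
  have hnn : ∀ i ∈ Finset.range N, 0 ≤ |c i| / m ^ i := fun i _ => by positivity
  rcases lt_or_ge j N with hj | hj
  · have h1 := Finset.single_le_sum hnn (Finset.mem_range.2 hj)
    rw [← div_le_iff₀ (by positivity)]
    have h2 : ‖g j z‖ / m ^ j ≤ |c j| / m ^ j := by
      gcongr
      exact (hc j z hz).trans (le_abs_self _)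
    linarith
  · refine (hN j hj z hz).trans (le_mul_of_one_le_left (by positivity) ?_)
    linarith [Finset.sum_nonneg hnn]

/-- If on an open disc `U = ball c r ⊆ D` one has
`limsup_j (1/j) log|f_j| < M₁`, then the Hartogs series converges locally uniformly on
`U × e^{-M₁}𝔻` to a holomorphic function `F` that agrees with `f` on
`G_{D,ρ} ∩ (U × e^{-M₁}𝔻)`. -/
theorem hartogs_series_extension (D : Set ℂ) (hDopen : IsOpen D) (hDconn : IsConnected D)
    (ρ : ℂ → EReal) (hρ : SubharmonicOn ρ D)
    (f : ℂ × ℂ → ℂ) (hf : DifferentiableOn ℂ f (hartogs D ρ))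
    (fj : ℕ → ℂ → ℂ) (hexp : HartogsExpansion D ρ f fj)
    (c : ℂ) (r : ℝ) (hr : 0 < r) (hUD : Metric.ball c r ⊆ D) (M₁ : ℝ)
    (hM₁ : ∀ z ∈ Metric.ball c r, coeffGrowth fj z < (M₁ : EReal)) :
    ∃ F : ℂ × ℂ → ℂ,
      TendstoLocallyUniformlyOn
        (fun N (p : ℂ × ℂ) => ∑ j ∈ Finset.range N, fj j p.1 * p.2 ^ j) F Filter.atTop
        (Metric.ball c r ×ˢ Metric.ball (0 : ℂ) (Real.exp (-M₁))) ∧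
      DifferentiableOn ℂ F (Metric.ball c r ×ˢ Metric.ball (0 : ℂ) (Real.exp (-M₁))) ∧
      Set.EqOn F f
        (hartogs D ρ ∩ Metric.ball c r ×ˢ Metric.ball (0 : ℂ) (Real.exp (-M₁))) := by
  have hlocal : ∀ p ∈ ball c r ×ˢ ball (0 : ℂ) (Real.exp (-M₁)), ∃ V, IsOpen V ∧ p ∈ V ∧
      V ⊆ D ×ˢ univ ∧ ∃ u : ℕ → ℝ, Summable u ∧
        ∀ j, ∀ q ∈ V, ‖fj j q.1 * q.2 ^ j‖ ≤ u j := by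
    rintro ⟨a, b⟩ ⟨ha, hb⟩
    obtain ⟨δ, hδ, B, hB0, hB⟩ := hexp.exists_local_bound hDopen hρ hf (hUD ha)
    obtain ⟨ε, hε, hεU⟩ := Metric.isOpen_iff.1 isOpen_ball a ha
    obtain ⟨s, hbs, hs⟩ := exists_between (mem_ball_zero_iff.1 hb)
    have hs0 : 0 < s := (norm_nonneg _).trans_lt hbs
    obtain ⟨m', hm', hm's⟩ : ∃ m', Real.exp M₁ < m' ∧ m' < s⁻¹ := by
      refine exists_between ?_
      rw [lt_inv_comm₀ (Real.exp_pos _) hs0, ← Real.exp_neg]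
      exact hs
    have hm'0 : 0 < m' := (Real.exp_pos _).trans hm'
    have hsubU : ball a (min δ ε) ⊆ ball c r := (ball_subset_ball (min_le_right _ _)).trans hεU
    obtain ⟨η, hη, hev⟩ := hartogs_lemma (lt_min hδ hε) (Real.exp_pos M₁) hm' hB0
      (fun j => (hexp.1 j).mono (hsubU.trans hUD))
      (fun j hj z hz => hB j hj z (ball_subset_ball (min_le_left _ _) hz))
      (fun z hz => eventually_norm_le_pow_of_coeffGrowth_lt (hM₁ z (hsubU hz)))
    obtain ⟨t, ht, htη⟩ : ∃ t, 0 < t ∧ t < min η ε := exists_between (lt_min hη hε)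
    have htD : closedBall a t ⊆ D :=
      (closedBall_subset_ball (htη.trans_le (min_le_right _ _))).trans (hεU.trans hUD)
    obtain ⟨C, hC⟩ := exists_geometric_bound (isCompact_closedBall a t)
      (fun j => (hexp.1 j).continuousOn.mono htD) hm'0
      (hev.mono fun j hj z hz =>
        hj z (closedBall_subset_ball (htη.trans_le (min_le_left _ _)) hz))
    refine ⟨ball a t ×ˢ ball 0 s, isOpen_ball.prod isOpen_ball,
      ⟨mem_ball_self ht, mem_ball_zero_iff.2 hbs⟩,
      prod_mono (ball_subset_closedBall.trans htD) (subset_univ _), fun j => C * (m' * s) ^ j,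
      (summable_geometric_of_lt_one (by positivity) ?_).mul_left C, ?_⟩
    · calc m' * s < s⁻¹ * s := by gcongr
        _ = 1 := inv_mul_cancel₀ hs0.ne'
    · rintro j ⟨z, w⟩ ⟨hz, hw⟩
      have h1 := hC j z (ball_subset_closedBall hz)
      have h2 : ‖w‖ ≤ s := (mem_ball_zero_iff.1 hw).le
      dsimp only
      rw [norm_mul, norm_pow, mul_pow, ← mul_assoc]
      have := (norm_nonneg _).trans h1
      gcongr
  refine ⟨fun p => ∑' j, fj j p.1 * p.2 ^ j, ?_, fun p hp => ?_, fun p hp => ?_⟩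
  · refine tendstoLocallyUniformlyOn_of_forall_exists_nhds fun p hp => ?_
    obtain ⟨V, hVo, hpV, -, u, hu, hbd⟩ := hlocal p hp
    exact ⟨V, mem_nhdsWithin_of_mem_nhds (hVo.mem_nhds hpV), tendstoUniformlyOn_tsum_nat hu hbd⟩
  · obtain ⟨V, hVo, hpV, hVD, u, hu, hbd⟩ := hlocal p hp
    refine ((differentiableOn_tsum_of_summable_bound hu hVo (fun j => ?_) hbd).differentiableAt
      (hVo.mem_nhds hpV)).differentiableWithinAt
    have : DifferentiableOn ℂ (fun q : ℂ × ℂ => fj j q.1) V :=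
      (hexp.1 j).comp differentiableOn_fst fun q hq => (hVD hq).1
    exact this.mul (differentiableOn_snd.pow j)
  · exact (hexp.2 p hp.1).tsum_eq
end

section
/- Let Ω ⊂ ℂ be an open set, u : Ω → [-∞,∞) a subharmonic function, and c ∈ ℝ. If the set {z ∈ Ω : u(z) ≥ c} is polar, then it is empty, i.e., u < c everywhere on Ω. -/
open MeasureTheory Filter Metric Set

theorem UpperSemicontinuousOn.isOpen_setOf_lt {X : Type*} [TopologicalSpace X] {u : X → EReal}
    {Ω : Set X} (hu : UpperSemicontinuousOn u Ω) (hΩ : IsOpen Ω) (a : EReal) :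
    IsOpen {z | z ∈ Ω ∧ u z < a} := by
  rw [isOpen_iff_mem_nhds]
  rintro z ⟨hz, hza⟩
  have h := hu z hz a hza
  rw [hΩ.nhdsWithin_eq hz] at h
  filter_upwards [h, hΩ.mem_nhds hz] with x hx hxΩ using ⟨hxΩ, hx⟩

theorem circle_mem_sphere (w : ℂ) {r : ℝ} (hr : 0 < r) (θ : ℝ) :
    w + r * Complex.exp (θ * Complex.I) ∈ Metric.sphere w r := by
  simp [Complex.norm_exp_ofReal_mul_I, abs_of_pos hr]

/-- Measure of the angular slice on `(0, 2π]` agrees with that on `(-π, π)`. -/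
theorem volume_circle_slice_eq (w : ℂ) (r : ℝ) {A : Set ℂ} (hA : MeasurableSet A) :
    volume ({θ : ℝ | w + r * Complex.exp (θ * Complex.I) ∈ A} ∩ Ioo (-Real.pi) Real.pi) =
      volume ({θ : ℝ | w + r * Complex.exp (θ * Complex.I) ∈ A} ∩ Ioc 0 (2 * Real.pi)) := by
  have hm : MeasurableSet {θ : ℝ | w + r * Complex.exp (θ * Complex.I) ∈ A} :=
    (by fun_prop : Measurable fun θ : ℝ => w + r * Complex.exp (θ * Complex.I)) hA
  have h1 := isAddFundamentalDomain_Ioc Real.two_pi_pos (-Real.pi) volume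
  have h2 := isAddFundamentalDomain_Ioc Real.two_pi_pos 0 volume
  have h3 := h1.measure_set_eq h2 hm (by
    rintro ⟨g, hg⟩
    obtain ⟨n, rfl⟩ := AddSubgroup.mem_zmultiples_iff.1 hg
    ext θ
    have : Complex.exp (((n • (2 * Real.pi) + θ : ℝ) : ℂ) * Complex.I) =
        Complex.exp (θ * Complex.I) := by
      rw [Complex.exp_eq_exp_iff_exists_int]
      exact ⟨n, by push_cast; simp; ring⟩
    simp only [mem_preimage, mem_ofPred_eq, AddSubgroup.vadd_def, vadd_eq_add]
    rw [this])
  have e : -Real.pi + 2 * Real.pi = Real.pi := by ring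
  rw [e, zero_add] at h3
  rw [← h3]
  exact measure_congr (ae_eq_set_inter (ae_eq_refl _) Ioo_ae_eq_Ioc)

/-- A measurable set is Lebesgue-null iff almost every circle about `w` meets it in a null set
of angles. -/
theorem volume_eq_zero_iff_circle_slices (w : ℂ) {A : Set ℂ} (hA : MeasurableSet A) :
    volume A = 0 ↔ ∀ᵐ r : ℝ, 0 < r →
      volume ({θ : ℝ | w + r * Complex.exp (θ * Complex.I) ∈ A} ∩ Ioc 0 (2 * Real.pi)) = 0 := by
  have hpol (p : ℝ × ℝ) : Complex.polarCoord.symm p = p.1 * Complex.exp (p.2 * Complex.I) := by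
    rw [Complex.polarCoord_symm_apply, Complex.exp_mul_I, Complex.ofReal_cos, Complex.ofReal_sin]
  have hT : MeasurableSet {p : ℝ × ℝ | w + p.1 * Complex.exp (p.2 * Complex.I) ∈ A} :=
    (by fun_prop : Measurable fun p : ℝ × ℝ => w + p.1 * Complex.exp (p.2 * Complex.I)) hA
  have htarget : polarCoord.target = Ioi (0 : ℝ) ×ˢ Ioo (-Real.pi) Real.pi := rfl
  have hvol : volume A = ∫⁻ z, A.indicator 1 (w + z) := by
    rw [lintegral_add_left_eq_self (fun z => A.indicator 1 z) w, lintegral_indicator_one hA]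
  rw [hvol, ← Complex.lintegral_comp_polarCoord_symm, htarget]
  simp_rw [hpol, ← volume_circle_slice_eq w _ hA]
  rw [lintegral_eq_zero_iff (by
    have := (measurable_one.indicator hA : Measurable (A.indicator (1 : ℂ → ENNReal)))
    simp only [smul_eq_mul]
    fun_prop)]
  have key : (∀ᵐ p : ℝ × ℝ ∂volume.restrict (Ioi (0 : ℝ) ×ˢ Ioo (-Real.pi) Real.pi),
      p ∉ {p : ℝ × ℝ | w + p.1 * Complex.exp (p.2 * Complex.I) ∈ A}) ↔
      ∀ᵐ r : ℝ, 0 < r → volume ({θ : ℝ | w + r * Complex.exp (θ * Complex.I) ∈ A} ∩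
        Ioo (-Real.pi) Real.pi) = 0 := by
    rw [← measure_eq_zero_iff_ae_notMem, Measure.volume_eq_prod, ← Measure.prod_restrict,
      Measure.measure_prod_null hT, Filter.EventuallyEq, ae_restrict_iff' measurableSet_Ioi]
    refine eventually_congr (Eventually.of_forall fun r => ?_)
    simp [Measure.restrict_apply' measurableSet_Ioo, preimage]
  rw [← key]
  rw [Filter.EventuallyEq, ae_restrict_iff' (measurableSet_Ioi.prod measurableSet_Ioo),
    ae_restrict_iff' (measurableSet_Ioi.prod measurableSet_Ioo)]
  refine eventually_congr (Eventually.of_forall fun p => ?_)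
  refine forall_congr' fun hp => ?_
  have : 0 < p.1 := hp.1
  simp [this, not_le]

theorem SubharmonicOn.exists_circle_bound {u : ℂ → EReal} {Ω : Set ℂ} (hu : SubharmonicOn u Ω)
    {w : ℂ} {r : ℝ} (hr : 0 < r) (hball : closedBall w r ⊆ Ω) :
    ∃ M : ℝ, ∀ θ : ℝ, u (w + r * Complex.exp (θ * Complex.I)) ≤ (M : EReal) := by
  have hsub : sphere w r ⊆ Ω := sphere_subset_closedBall.trans hball
  obtain ⟨z, hz, hmax⟩ := UpperSemicontinuousOn.exists_isMaxOn
    (NormedSpace.sphere_nonempty.2 hr.le) (isCompact_sphere w r) (hu.2.1.mono hsub)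
  obtain ⟨M, hM, -⟩ :=
    EReal.lt_iff_exists_real_btwn.1 (lt_top_iff_ne_top.2 (hu.2.2.1 z (hsub hz)))
  exact ⟨M, fun θ => (hmax (circle_mem_sphere w hr θ)).trans hM.le⟩

/-- If `u ≤ M` on a circle, and `u < a` for angles in `S`, then the value at the centre is at most
the mean of the corresponding step function. -/
theorem SubharmonicOn.le_step_mean {u : ℂ → EReal} {Ω : Set ℂ} (hu : SubharmonicOn u Ω)
    {w : ℂ} {r : ℝ} (hr : 0 < r) (hball : closedBall w r ⊆ Ω) {M a : ℝ} (haM : a ≤ M)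
    (hM : ∀ θ : ℝ, u (w + r * Complex.exp (θ * Complex.I)) ≤ (M : EReal)) :
    u w ≤ ((M - (M - a) * (2 * Real.pi)⁻¹ *
      (volume ({θ : ℝ | u (w + r * Complex.exp (θ * Complex.I)) < (a : EReal)} ∩
        Ioc 0 (2 * Real.pi))).toReal : ℝ) : EReal) := by
  set S : Set ℝ := {θ : ℝ | u (w + r * Complex.exp (θ * Complex.I)) < (a : EReal)}
  have hπ := Real.two_pi_pos
  have hmem (θ : ℝ) : w + r * Complex.exp (θ * Complex.I) ∈ Ω :=
    hball (sphere_subset_closedBall (circle_mem_sphere w hr θ))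
  have hSo : IsOpen S := by
    have h := (hu.2.1.isOpen_setOf_lt hu.1 a).preimage
      (by fun_prop : Continuous fun θ : ℝ => w + r * Complex.exp (θ * Complex.I))
    convert! h using 1
    ext θ
    simp [S, hmem θ]
  have hfin : volume (S ∩ Ioc 0 (2 * Real.pi)) ≠ ⊤ :=
    ((measure_mono inter_subset_right).trans_lt measure_Ioc_lt_top).ne
  have step (t : ℝ) (ht0 : 0 ≤ t) (ht : t < (volume (S ∩ Ioc 0 (2 * Real.pi))).toReal) :
      u w ≤ ((M - (M - a) * (2 * Real.pi)⁻¹ * t : ℝ) : EReal) := by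
    obtain ⟨K, hKS, hK, htK⟩ := (hSo.measurableSet.inter measurableSet_Ioc).exists_lt_isCompact
      ((ENNReal.ofReal_lt_iff_lt_toReal ht0 hfin).2 ht)
    obtain ⟨f, hf0, hf1, hf⟩ := exists_continuous_zero_one_of_isClosed hSo.isClosed_compl
      hK.isClosed (disjoint_compl_left_iff_subset.2 (hKS.trans inter_subset_left))
    have hsm := hu.2.2.2.2 w r hr hball (fun θ => M - (M - a) * f θ) (by fun_prop) (fun θ => by
      by_cases hθ : θ ∈ S
      · refine (le_of_lt hθ).trans (EReal.coe_le_coe_iff.2 ?_)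
        nlinarith [(hf θ).2]
      · have : f θ = 0 := hf0 hθ
        simpa [this] using hM θ)
    refine hsm.trans (EReal.coe_le_coe_iff.2 ?_)
    have hint : t ≤ ∫ θ in (0 : ℝ)..(2 * Real.pi), f θ := by
      rw [intervalIntegral.integral_of_le hπ.le]
      have hi : IntegrableOn (fun θ => f θ) (Ioc 0 (2 * Real.pi)) :=
        (f.continuous.integrableOn_Icc).mono_set Ioc_subset_Icc_self
      have hKsub : K ⊆ Ioc 0 (2 * Real.pi) := hKS.trans inter_subset_right
      calc t ≤ (volume K).toReal :=
            (ENNReal.ofReal_le_iff_le_toReal hK.measure_lt_top.ne).1 htK.le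
        _ = ∫ θ in K, (1 : ℝ) := by simp [Measure.real]
        _ = ∫ θ in K, f θ := setIntegral_congr_fun hK.measurableSet fun θ hθ => (hf1 hθ).symm
        _ ≤ ∫ θ in Ioc 0 (2 * Real.pi), f θ :=
            setIntegral_mono_set hi (Eventually.of_forall fun θ => (hf θ).1)
              hKsub.eventuallyLE
    rw [intervalIntegral.integral_sub (by simp) ((by fun_prop : Continuous fun θ =>
      (M - a) * f θ).intervalIntegrable _ _), intervalIntegral.integral_const,
      intervalIntegral.integral_const_mul]
    have h1 : (2 * Real.pi)⁻¹ * ((2 * Real.pi - 0) • M - (M - a) * ∫ θ in (0 : ℝ)..2 * Real.pi, f θ)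
        = M - (M - a) * (2 * Real.pi)⁻¹ * ∫ θ in (0 : ℝ)..2 * Real.pi, f θ := by
      simp only [smul_eq_mul, sub_zero]
      field_simp
    rw [h1]
    have : 0 ≤ (M - a) * (2 * Real.pi)⁻¹ := mul_nonneg (by linarith) (by positivity)
    gcongr
  rcases (ENNReal.toReal_nonneg (a := volume (S ∩ Ioc 0 (2 * Real.pi)))).eq_or_lt with h0 | h0
  · have hsm := hu.2.2.2.2 w r hr hball (fun _ => M) continuous_const hM
    rw [← h0]
    convert! hsm using 2
    rw [intervalIntegral.integral_const, smul_eq_mul]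
    field_simp
    ring
  · refine EReal.le_of_forall_lt_iff_le.1 fun b hb => ?_
    rw [EReal.coe_lt_coe_iff] at hb
    have hcont : Tendsto (fun t : ℝ => M - (M - a) * (2 * Real.pi)⁻¹ * t)
        (nhdsWithin (volume (S ∩ Ioc 0 (2 * Real.pi))).toReal (Iio (volume (S ∩ Ioc 0 (2 * Real.pi))).toReal)) (nhds _) :=
      ((by fun_prop : Continuous fun t : ℝ =>
        M - (M - a) * (2 * Real.pi)⁻¹ * t).tendsto _).mono_left nhdsWithin_le_nhds
    obtain ⟨t, htb, ht⟩ := ((hcont.eventually (gt_mem_nhds hb)).and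
      (Ioo_mem_nhdsLT h0)).exists
    exact (step t ht.1.le ht.2).trans (EReal.coe_le_coe_iff.2 htb.le)

/-- A subharmonic function equal to `-∞` on a set of positive length of a circle is `-∞` at the
centre. -/
theorem SubharmonicOn.eq_bot_of_circle_slice {v : ℂ → EReal} {Ω : Set ℂ} (hv : SubharmonicOn v Ω)
    {w : ℂ} {r : ℝ} (hr : 0 < r) (hball : closedBall w r ⊆ Ω)
    (hpos : volume ({θ : ℝ | v (w + r * Complex.exp (θ * Complex.I)) = ⊥} ∩
      Ioc 0 (2 * Real.pi)) ≠ 0) : v w = ⊥ := by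
  obtain ⟨M, hM⟩ := hv.exists_circle_bound hr hball
  set m := (volume ({θ : ℝ | v (w + r * Complex.exp (θ * Complex.I)) = ⊥} ∩
      Ioc 0 (2 * Real.pi))).toReal
  have hlt (S : Set ℝ) : volume (S ∩ Ioc 0 (2 * Real.pi)) ≠ ⊤ :=
    ((measure_mono inter_subset_right).trans_lt measure_Ioc_lt_top).ne
  have hm0 : 0 < m := ENNReal.toReal_pos hpos (hlt _)
  have hk : 0 < (2 * Real.pi)⁻¹ * m := mul_pos (inv_pos.2 Real.two_pi_pos) hm0
  rw [EReal.eq_bot_iff_forall_lt]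
  intro y
  obtain ⟨N, hN⟩ := exists_gt (max 0 ((M - y) / ((2 * Real.pi)⁻¹ * m)))
  have hN0 : 0 < N := (le_max_left _ _).trans_lt hN
  have hNy := (div_lt_iff₀ hk).1 ((le_max_right _ _).trans_lt hN)
  refine (hv.le_step_mean hr hball (a := M - N) (by linarith) hM).trans_lt ?_
  rw [EReal.coe_lt_coe_iff]
  have hmono : m ≤ (volume ({θ : ℝ | v (w + r * Complex.exp (θ * Complex.I)) <
      ((M - N : ℝ) : EReal)} ∩ Ioc 0 (2 * Real.pi))).toReal := by
    refine ENNReal.toReal_mono (hlt _) (measure_mono (inter_subset_inter_left _ fun θ hθ => ?_))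
    simp only [mem_ofPred_eq] at hθ ⊢
    rw [hθ]
    exact EReal.bot_lt_coe _
  have := mul_le_mul_of_nonneg_left hmono (by positivity : 0 ≤ N * (2 * Real.pi)⁻¹)
  have e : M - (M - N) = N := by ring
  rw [e]
  linarith

theorem SubharmonicOn.measurableSet_bot {v : ℂ → EReal} {Ω : Set ℂ} (hv : SubharmonicOn v Ω) :
    MeasurableSet {z | z ∈ Ω ∧ v z = ⊥} := by
  have : {z | z ∈ Ω ∧ v z = ⊥} = ⋂ n : ℕ, {z | z ∈ Ω ∧ v z < ((-(n : ℝ) : ℝ) : EReal)} := by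
    ext z
    simp only [mem_ofPred_eq, mem_iInter]
    refine ⟨fun h n => ⟨h.1, h.2 ▸ EReal.bot_lt_coe _⟩, fun h => ⟨(h 0).1, ?_⟩⟩
    rw [EReal.eq_bot_iff_forall_lt]
    intro y
    obtain ⟨n, hn⟩ := exists_nat_gt (-y)
    exact (h n).2.trans (EReal.coe_lt_coe_iff.2 (by linarith))
  rw [this]
  exact MeasurableSet.iInter fun n => (hv.2.1.isOpen_setOf_lt hv.1 _).measurableSet

/-- The `-∞` set of a subharmonic function is Lebesgue-null. -/
theorem SubharmonicOn.volume_bot_eq_zero {v : ℂ → EReal} {Ω : Set ℂ} (hv : SubharmonicOn v Ω) :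
    volume {z | z ∈ Ω ∧ v z = ⊥} = 0 := by
  set E : Set ℂ := {z | z ∈ Ω ∧ v z = ⊥}
  set A : Set ℂ := {z | ∃ U : Set ℂ, IsOpen U ∧ z ∈ U ∧ volume (E ∩ U) = 0}
  have hAo : IsOpen A := by
    rw [isOpen_iff_mem_nhds]
    rintro z ⟨U, hU, hz, h0⟩
    filter_upwards [hU.mem_nhds hz] with x hx using ⟨U, hU, hx, h0⟩
  have hdisj : Disjoint (interior E) A := by
    rw [Set.disjoint_left]
    rintro z hz ⟨U, hU, hzU, h0⟩
    refine (isOpen_interior.inter hU).measure_ne_zero volume ⟨z, hz, hzU⟩ ?_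
    exact measure_mono_null (inter_subset_inter_left _ interior_subset) h0
  have hcover : Ω ⊆ interior E ∪ A := by
    intro z hz
    by_cases hzA : z ∈ A
    · exact Or.inr hzA
    left
    obtain ⟨ε, hε, hball⟩ := Metric.isOpen_iff.1 hv.1 z hz
    have hR : 0 < ε / 3 := by positivity
    refine mem_interior.2 ⟨ball z (ε / 3), fun w hw => ?_, isOpen_ball, mem_ball_self hR⟩
    have hw' : dist w z < ε / 3 := hw
    refine ⟨hball (mem_ball.2 (by linarith)), ?_⟩
    have hne : volume (E ∩ ball z (ε / 3)) ≠ 0 :=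
      fun h => hzA ⟨_, isOpen_ball, mem_ball_self hR, h⟩
    rw [Ne, volume_eq_zero_iff_circle_slices w (hv.measurableSet_bot.inter measurableSet_ball)]
      at hne
    obtain ⟨r, hr⟩ := (not_eventually.1 hne).exists
    rw [Classical.not_imp] at hr
    obtain ⟨hr, hpos⟩ := hr
    obtain ⟨θ, ⟨-, hθ⟩, -⟩ := nonempty_of_measure_ne_zero hpos
    have hθr : dist (w + r * Complex.exp (θ * Complex.I)) w = r := circle_mem_sphere w hr θ
    rw [mem_ball] at hθ
    have hr2 : r < 2 * (ε / 3) := by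
      have := dist_triangle_right (w + r * Complex.exp (θ * Complex.I)) w z
      linarith
    refine hv.eq_bot_of_circle_slice hr (fun x hx => hball ?_) (fun h => hpos ?_)
    · rw [mem_closedBall] at hx
      have := dist_triangle x w z
      rw [mem_ball]
      linarith
    · exact measure_mono_null (inter_subset_inter_left _ fun θ hθ => hθ.1.2) h
  refine measure_null_of_locally_null E fun z hz => ?_
  rcases hcover hz.1 with hzi | ⟨U, hU, hzU, h0⟩
  · exfalso
    obtain ⟨y, hy, hyv⟩ := hv.2.2.2.1 z hz.1
    have := isPreconnected_connectedComponentIn.subset_left_of_subset_union isOpen_interior hAo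
      hdisj ((connectedComponentIn_subset Ω z).trans hcover)
      ⟨z, mem_connectedComponentIn hz.1, hzi⟩ hy
    exact hyv (interior_subset this).2
  · exact ⟨E ∩ U, inter_mem_nhdsWithin _ (hU.mem_nhds hzU), h0⟩

theorem PolarSet.volume_eq_zero {E : Set ℂ} (hE : PolarSet E) : volume E = 0 := by
  obtain ⟨Ω, hΩ, v, hv, hbot⟩ := hE
  have hsub : E ⊆ {z | z ∈ Ω ∧ v z = ⊥} := fun z hz => ⟨hΩ hz, hbot z hz⟩
  exact measure_mono_null hsub hv.volume_bot_eq_zero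

/-- If `u < c` almost everywhere, then about each point there is a closed disc in `Ω` with
`u < c` at almost every angle of its bounding circle. -/
theorem SubharmonicOn.exists_circle_lt {u : ℂ → EReal} {Ω : Set ℂ} (hu : SubharmonicOn u Ω)
    {c : EReal} (h0 : volume {z | z ∈ Ω ∧ c ≤ u z} = 0) {z : ℂ} (hz : z ∈ Ω) :
    ∃ r : ℝ, 0 < r ∧ closedBall z r ⊆ Ω ∧
      volume ({θ : ℝ | u (z + r * Complex.exp (θ * Complex.I)) < c} ∩ Ioc 0 (2 * Real.pi)) =
        ENNReal.ofReal (2 * Real.pi) := by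
  obtain ⟨ε, hε, hball⟩ := Metric.isOpen_iff.1 hu.1 z hz
  have hmeas : MeasurableSet {z | z ∈ Ω ∧ c ≤ u z} := by
    convert! hu.1.measurableSet.diff (hu.2.1.isOpen_setOf_lt hu.1 c).measurableSet using 1
    ext x
    simp +contextual
  rw [volume_eq_zero_iff_circle_slices z hmeas] at h0
  have hfreq : ∃ᵐ r : ℝ, r ∈ Ioo 0 ε := by
    rw [frequently_ae_mem_iff]
    simp [hε]
  obtain ⟨r, hr, hslice⟩ := (hfreq.and_eventually h0).exists
  have hsub : closedBall z r ⊆ Ω := (closedBall_subset_ball hr.2).trans hball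
  refine ⟨r, hr.1, hsub, le_antisymm ?_ ?_⟩
  · refine (measure_mono inter_subset_right).trans ?_
    simp
  · calc ENNReal.ofReal (2 * Real.pi) = volume (Ioc 0 (2 * Real.pi)) := by simp
      _ ≤ _ := measure_mono (t :=
          ({θ : ℝ | u (z + r * Complex.exp (θ * Complex.I)) < c} ∩ Ioc 0 (2 * Real.pi)) ∪
          ({θ : ℝ | z + r * Complex.exp (θ * Complex.I) ∈ {z | z ∈ Ω ∧ c ≤ u z}} ∩
            Ioc 0 (2 * Real.pi))) (fun θ hθ => by
          rcases lt_or_ge (u (z + r * Complex.exp (θ * Complex.I))) c with h | h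
          · exact Or.inl ⟨h, hθ⟩
          · exact Or.inr ⟨⟨hsub (sphere_subset_closedBall (circle_mem_sphere z hr.1 θ)), h⟩, hθ⟩)
      _ ≤ _ := measure_union_le _ _
      _ = _ := by rw [hslice hr.1, add_zero]

/-- If `u` is subharmonic on an open `Ω ⊆ ℂ` and the superlevel set
`{z ∈ Ω : u z ≥ c}` is polar, then it is empty, i.e. `u < c` on `Ω`. -/
theorem subharmonic_superlevel_polar_empty (Ω : Set ℂ) (u : ℂ → EReal)
    (hu : SubharmonicOn u Ω) (c : ℝ)
    (hpolar : PolarSet {z | z ∈ Ω ∧ (c : EReal) ≤ u z}) :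
    ∀ z ∈ Ω, u z < (c : EReal) := by
  have h0 := hpolar.volume_eq_zero
  have hle : ∀ z ∈ Ω, u z ≤ (c : EReal) := by
    intro z hz
    obtain ⟨r, hr, hball, hfull⟩ := hu.exists_circle_lt h0 hz
    obtain ⟨M, hM⟩ := hu.exists_circle_bound hr hball
    have h := hu.le_step_mean hr hball (le_max_right M c)
      fun θ => (hM θ).trans (EReal.coe_le_coe_iff.2 (le_max_left M c))
    rw [hfull, ENNReal.toReal_ofReal Real.two_pi_pos.le, mul_assoc,
      inv_mul_cancel₀ Real.two_pi_pos.ne'] at h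
    simpa using h
  intro z hz
  obtain ⟨r, hr, hball, hfull⟩ := hu.exists_circle_lt h0 hz
  have hM (θ : ℝ) : u (z + r * Complex.exp (θ * Complex.I)) ≤ (c : EReal) :=
    hle _ (hball (sphere_subset_closedBall (circle_mem_sphere z hr θ)))
  obtain ⟨q, hqc, hq⟩ : ∃ q : ℚ, (q : ℝ) < c ∧
      volume ({θ : ℝ | u (z + r * Complex.exp (θ * Complex.I)) < ((q : ℝ) : EReal)} ∩
        Ioc 0 (2 * Real.pi)) ≠ 0 := by
    by_contra! hcon
    have hnull : volume (⋃ q : {q : ℚ // (q : ℝ) < c},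
        ({θ : ℝ | u (z + r * Complex.exp (θ * Complex.I)) < ((q.1 : ℝ) : EReal)} ∩
          Ioc 0 (2 * Real.pi))) = 0 := measure_iUnion_null fun q => hcon q.1 q.2
    have hzero := measure_mono_null (fun θ hθ => by
      obtain ⟨q, hq1, hq2⟩ := EReal.lt_iff_exists_rat_btwn.1 hθ.1
      exact mem_iUnion.2 ⟨⟨q, EReal.coe_lt_coe_iff.1 hq2⟩, hq1, hθ.2⟩ :
        {θ : ℝ | u (z + r * Complex.exp (θ * Complex.I)) < (c : EReal)} ∩ Ioc 0 (2 * Real.pi) ⊆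
          _) hnull
    rw [hfull, ENNReal.ofReal_eq_zero] at hzero
    exact hzero.not_gt Real.two_pi_pos
  refine (hu.le_step_mean hr hball hqc.le hM).trans_lt (EReal.coe_lt_coe_iff.2 ?_)
  have hpos := ENNReal.toReal_pos hq
    ((measure_mono inter_subset_right).trans_lt measure_Ioc_lt_top).ne
  have : 0 < (c - q) * (2 * Real.pi)⁻¹ :=
    mul_pos (sub_pos.2 hqc) (inv_pos.2 Real.two_pi_pos)
  exact sub_lt_self _ (mul_pos this hpos)
end
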